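/- arXiv:quant-ph/0606049 — 10 statements merged into one kernel-verified Lean document; each statement's English description precedes it below -/
import Mathlib

section
/- Let 𝒱 be a finite alphabet and N ≥ 1. Suppose ℰ ⊆ 𝒱^N is an event and ε > 0 are such that for every probability distribution P_V on 𝒱 the i.i.d. product distribution satisfies (P_V)^{⊗N}(ℰ) ≤ ε. Then every symmetric probability distribution P on 𝒱^N satisfies P(ℰ) ≤ ε·|𝒬|. -/
open scoped Classical
open Finset

/-- The frequency (type) of a string `v ∈ 𝒱^N`, as a probability distribution on `𝒱`. -/
noncomputable def freq {V : Type*} [Fintype V] [DecidableEq V] {N : ℕ} (v : Fin N → V) : V → ℝ :=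
  fun u => ((Finset.univ.filter fun n => v n = u).card : ℝ) / N

/-- The number of occurrences of each letter in the string `v`. -/
def letterCount {ι V : Type*} [Fintype ι] [DecidableEq V] (v : ι → V) (u : V) : ℕ :=
  (Finset.univ.filter fun n => v n = u).card

lemma sum_letterCount {ι V : Type*} [Fintype ι] [Fintype V] [DecidableEq V] (v : ι → V) :
    ∑ u, letterCount v u = Fintype.card ι :=
  (Finset.card_eq_sum_card_fiberwise fun n _ => Finset.mem_univ (v n)).symm

lemma prod_comp_eq_prod_pow_letterCount {ι V : Type*} [Fintype ι] [Fintype V] [DecidableEq V]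
    (p : V → ℝ) (v : ι → V) : ∏ n, p (v n) = ∏ u, p u ^ letterCount v u := by
  rw [← Finset.prod_fiberwise Finset.univ v fun n => p (v n)]
  refine Finset.prod_congr rfl fun u _ => ?_
  rw [letterCount, ← Finset.prod_const]
  exact Finset.prod_congr rfl fun n hn => by rw [(Finset.mem_filter.mp hn).2]

lemma freq_eq_iff_letterCount_eq {V : Type*} [Fintype V] [DecidableEq V] {N : ℕ} (hN : 1 ≤ N)
    (v w : Fin N → V) : freq v = freq w ↔ letterCount v = letterCount w := by
  have hN' : (N : ℝ) ≠ 0 := by positivity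
  simp only [funext_iff]
  refine forall_congr' fun u => ?_
  simp only [freq, letterCount]
  rw [div_left_inj' hN', Nat.cast_inj]

/-- Two strings with the same letter counts differ by a permutation of the positions. -/
lemma exists_perm_of_letterCount_eq {ι V : Type*} [Fintype ι] [DecidableEq V] {v w : ι → V}
    (h : letterCount w = letterCount v) : ∃ σ : Equiv.Perm ι, v ∘ σ = w := by
  have e (u : V) : {n // w n = u} ≃ {n // v n = u} :=
    Fintype.equivOfCardEq (by
      rw [Fintype.card_subtype, Fintype.card_subtype]
      exact congrFun h u)
  refine ⟨(Equiv.sigmaFiberEquiv w).symm.trans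
    ((Equiv.sigmaCongrRight e).trans (Equiv.sigmaFiberEquiv v)), ?_⟩
  ext n
  exact (e (w n) ⟨n, rfl⟩).2

lemma letterCount_comp_perm {ι V : Type*} [Fintype ι] [DecidableEq V] (v : ι → V)
    (σ : Equiv.Perm ι) : letterCount (v ∘ σ) = letterCount v := by
  ext u
  exact Finset.card_equiv σ (by simp)

/-- The size of a type class is a multinomial coefficient. -/
lemma card_letterCount_eq_mul_prod_factorial {ι V : Type*} [Fintype ι] [DecidableEq ι] [Fintype V]
    [DecidableEq V] (v : ι → V) :
    (Finset.univ.filter fun w : ι → V => letterCount w = letterCount v).card *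
      ∏ u, (letterCount v u).factorial = (Fintype.card ι).factorial := by
  have hfib : ∀ w ∈ Finset.univ.filter (fun w : ι → V => letterCount w = letterCount v),
      (Finset.univ.filter fun σ : Equiv.Perm ι => v ∘ σ = w).card =
        ∏ u, (letterCount v u).factorial := by
    intro w hw
    obtain ⟨τ, rfl⟩ := exists_perm_of_letterCount_eq (Finset.mem_filter.mp hw).2
    have hstab := DomMulAct.stabilizer_card v
    simp only [Fintype.card_subtype] at hstab
    simp only [letterCount]
    rw [← hstab]
    refine Finset.card_equiv (Equiv.mulRight τ⁻¹) fun σ => ?_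
    simp only [Finset.mem_filter, Finset.mem_univ, true_and, funext_iff, Function.comp_apply,
      Equiv.coe_mulRight, Equiv.Perm.mul_apply]
    refine ⟨fun h n => by simpa using h (τ⁻¹ n), fun h n => by simpa using h (τ n)⟩
  rw [← Fintype.card_perm, ← Finset.card_univ, Finset.card_eq_sum_card_fiberwise
    (f := fun σ : Equiv.Perm ι => v ∘ σ)
    (t := Finset.univ.filter fun w : ι → V => letterCount w = letterCount v)
    (fun σ _ => by simp [letterCount_comp_perm]), Finset.sum_congr rfl hfib, Finset.sum_const,
    smul_eq_mul]

lemma factorial_mul_pow_le_factorial_mul_pow_self (k m : ℕ) :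
    k.factorial * k ^ m ≤ m.factorial * k ^ k := by
  rcases le_total k m with h | h
  · obtain ⟨d, rfl⟩ := Nat.exists_eq_add_of_le h
    have := Nat.factorial_mul_pow_sub_le_factorial h
    rw [Nat.add_sub_cancel_left] at this
    calc k.factorial * k ^ (k + d) = k.factorial * k ^ d * k ^ k := by ring
      _ ≤ _ := Nat.mul_le_mul_right _ this
  · have := Nat.factorial_mul_pow_sub_le_factorial h
    obtain ⟨d, rfl⟩ := Nat.exists_eq_add_of_le h
    have h2 : (m + d).factorial ≤ m.factorial * (m + d) ^ d := by
      rw [← Nat.factorial_mul_ascFactorial]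
      exact Nat.mul_le_mul_left _ (Nat.ascFactorial_le_pow_add m d)
    calc (m + d).factorial * (m + d) ^ m ≤ m.factorial * (m + d) ^ d * (m + d) ^ m :=
          Nat.mul_le_mul_right _ h2
      _ = m.factorial * (m + d) ^ (m + d) := by ring

/-- Under the i.i.d. distribution with marginal `freq v`, the type class of `v` is the most
likely one. -/
lemma card_mul_prod_freq_pow_le {V : Type*} [Fintype V] [DecidableEq V] {N : ℕ}
    (v w : Fin N → V) :
    ((Finset.univ.filter fun x : Fin N → V => letterCount x = letterCount w).card : ℝ) *
        ∏ u, freq v u ^ letterCount w u ≤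
      ((Finset.univ.filter fun x : Fin N → V => letterCount x = letterCount v).card : ℝ) *
        ∏ u, freq v u ^ letterCount v u := by
  have hpow (x : Fin N → V) : ∏ u, freq v u ^ letterCount x u =
      ((∏ u, letterCount v u ^ letterCount x u : ℕ) : ℝ) / (N : ℝ) ^ N := by
    have hsum := sum_letterCount x
    rw [Fintype.card_fin] at hsum
    have hf (u : V) : freq v u = (letterCount v u : ℝ) / N := rfl
    simp only [hf, div_pow, Finset.prod_div_distrib, Finset.prod_pow_eq_pow_sum, hsum]
    push_cast
    rfl
  rw [hpow, hpow, ← mul_div_assoc, ← mul_div_assoc]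
  refine div_le_div_of_nonneg_right ?_ (by positivity)
  have hv := card_letterCount_eq_mul_prod_factorial v
  have hw := card_letterCount_eq_mul_prod_factorial w
  set a := (Finset.univ.filter fun x : Fin N → V => letterCount x = letterCount v).card
  set b := (Finset.univ.filter fun x : Fin N → V => letterCount x = letterCount w).card
  have hprod := Finset.prod_le_prod' fun u (_ : u ∈ Finset.univ) =>
    factorial_mul_pow_le_factorial_mul_pow_self (letterCount v u) (letterCount w u)
  simp only [Finset.prod_mul_distrib] at hprod
  have hpos : 0 < ∏ u, (letterCount v u).factorial :=
    Finset.prod_pos fun u _ => Nat.factorial_pos _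
  norm_cast
  refine Nat.le_of_mul_le_mul_left ?_ hpos
  calc _ = b * ((∏ u, (letterCount v u).factorial) * ∏ u, letterCount v u ^ letterCount w u) := by
        ring
    _ ≤ b * ((∏ u, (letterCount w u).factorial) * ∏ u, letterCount v u ^ letterCount v u) :=
        Nat.mul_le_mul_left _ hprod
    _ = (b * ∏ u, (letterCount w u).factorial) * ∏ u, letterCount v u ^ letterCount v u := by ring
    _ = (a * ∏ u, (letterCount v u).factorial) * ∏ u, letterCount v u ^ letterCount v u := by
        rw [hv, hw]
    _ = _ := by ring

lemma freq_nonneg {V : Type*} [Fintype V] [DecidableEq V] {N : ℕ} (v : Fin N → V) (u : V) :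
    0 ≤ freq v u := by
  unfold freq
  positivity

lemma sum_freq {V : Type*} [Fintype V] [DecidableEq V] {N : ℕ} (hN : 1 ≤ N) (v : Fin N → V) :
    ∑ u, freq v u = 1 := by
  have hsum := sum_letterCount v
  rw [Fintype.card_fin] at hsum
  have hf (u : V) : freq v u = (letterCount v u : ℝ) / N := rfl
  simp only [hf, ← Finset.sum_div]
  rw [← Nat.cast_sum, hsum, div_self (by positivity)]

/-- Under the i.i.d. distribution with marginal `freq v`, the type class of `v` has probability at
least the inverse of the number of types. -/
lemma one_le_card_freq_mul {V : Type*} [Fintype V] [DecidableEq V] {N : ℕ} (hN : 1 ≤ N)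
    (v : Fin N → V) :
    1 ≤ ((Finset.univ.image (freq (V := V) (N := N))).card : ℝ) *
      (((Finset.univ.filter fun x : Fin N → V => freq x = freq v).card : ℝ) *
        ∏ u, freq v u ^ letterCount v u) := by
  have htotal : ∑ x : Fin N → V, ∏ n, freq v (x n) = 1 := by
    rw [← Fintype.piFinset_univ, Finset.sum_prod_piFinset]
    simp [sum_freq hN]
  rw [← htotal, ← Finset.sum_fiberwise_of_maps_to (t := Finset.univ.image (freq (V := V) (N := N)))
    fun x _ => Finset.mem_image_of_mem freq (Finset.mem_univ x), ← nsmul_eq_mul]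
  refine Finset.sum_le_card_nsmul _ _ _ fun q hq => ?_
  obtain ⟨w, -, rfl⟩ := Finset.mem_image.mp hq
  have hconst : ∀ x ∈ Finset.univ.filter (fun x : Fin N → V => freq x = freq w),
      ∏ n, freq v (x n) = ∏ u, freq v u ^ letterCount w u := fun x hx => by
    rw [prod_comp_eq_prod_pow_letterCount,
      (freq_eq_iff_letterCount_eq hN x w).mp (Finset.mem_filter.mp hx).2]
  rw [Finset.sum_congr rfl hconst, Finset.sum_const, nsmul_eq_mul]
  simp only [freq_eq_iff_letterCount_eq hN]
  convert card_mul_prod_freq_pow_le v w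

/-- If an event `ℰ ⊆ 𝒱^N` has probability at most `ε` under every i.i.d. product
distribution, then it has probability at most `ε·|𝒬|` under every symmetric distribution,
where `𝒬` is the set of all frequencies of strings of length `N`. -/
theorem iid_bound_implies_symmetric_bound
    {V : Type*} [Fintype V] [DecidableEq V] (N : ℕ) (hN : 1 ≤ N)
    (ℰ : Finset (Fin N → V)) (ε : ℝ) (hε : 0 < ε)
    (hiid : ∀ p : V → ℝ, (∀ u, 0 ≤ p u) → (∑ u, p u) = 1 →
      ∑ v ∈ ℰ, (∏ n, p (v n)) ≤ ε)
    (P : (Fin N → V) → ℝ) (hP0 : ∀ v, 0 ≤ P v) (hP1 : ∑ v, P v = 1)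
    (hsym : ∀ (σ : Equiv.Perm (Fin N)) (v : Fin N → V), P (v ∘ σ) = P v) :
    ∑ v ∈ ℰ, P v ≤ ε * (Set.range (freq (V := V) (N := N))).ncard := by
  set K := Finset.univ.image (freq (V := V) (N := N)) with hK
  have hcard : (Set.range (freq (V := V) (N := N))).ncard = K.card := by
    rw [← Set.ncard_coe_finset, hK, Finset.coe_image, Finset.coe_univ, Set.image_univ]
  have hmaps (v : Fin N → V) : freq v ∈ K := Finset.mem_image_of_mem freq (Finset.mem_univ v)
  rw [hcard, ← mul_one (ε * _), ← hP1,
    ← Finset.sum_fiberwise_of_maps_to (s := ℰ) (t := K) (g := freq) (fun v _ => hmaps v),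
    ← Finset.sum_fiberwise_of_maps_to (s := Finset.univ) (t := K) (g := freq) (fun v _ => hmaps v),
    Finset.mul_sum]
  refine Finset.sum_le_sum fun q hq => ?_
  obtain ⟨v, -, rfl⟩ := Finset.mem_image.mp hq
  have hconst (x : Fin N → V) (hx : freq x = freq v) : P x = P v := by
    obtain ⟨σ, rfl⟩ := exists_perm_of_letterCount_eq ((freq_eq_iff_letterCount_eq hN x v).mp hx)
    exact hsym σ v
  rw [Finset.sum_congr rfl fun x hx => hconst x (Finset.mem_filter.mp hx).2,
    Finset.sum_congr rfl fun x hx => hconst x (Finset.mem_filter.mp hx).2,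
    Finset.sum_const, Finset.sum_const, nsmul_eq_mul, nsmul_eq_mul, ← mul_assoc]
  refine mul_le_mul_of_nonneg_right ?_ (hP0 v)
  set c := ∏ u, freq v u ^ letterCount v u
  set T := Finset.univ.filter fun x : Fin N → V => freq x = freq v
  have hevent : ((ℰ.filter fun x => freq x = freq v).card : ℝ) * c ≤ ε := by
    refine le_trans ?_ (hiid (freq v) (freq_nonneg v) (sum_freq hN v))
    rw [← nsmul_eq_mul, ← Finset.sum_const]
    refine le_trans (Finset.sum_le_sum fun x hx => ?_) (Finset.sum_le_sum_of_subset_of_nonneg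
      (Finset.filter_subset (fun x => freq x = freq v) ℰ)
      fun x _ _ => Finset.prod_nonneg fun n _ => freq_nonneg v (x n))
    rw [prod_comp_eq_prod_pow_letterCount,
      (freq_eq_iff_letterCount_eq hN x v).mp (Finset.mem_filter.mp hx).2]
  have hmass : 1 ≤ (K.card : ℝ) * ((T.card : ℝ) * c) := one_le_card_freq_mul hN v
  calc ((ℰ.filter fun x => freq x = freq v).card : ℝ)
      ≤ ((ℰ.filter fun x => freq x = freq v).card : ℝ) * ((K.card : ℝ) * ((T.card : ℝ) * c)) :=
        le_mul_of_one_le_right (by positivity) hmass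
    _ = ((ℰ.filter fun x => freq x = freq v).card : ℝ) * c * (K.card * T.card) := by ring
    _ ≤ ε * (K.card * T.card) := mul_le_mul_of_nonneg_right hevent (by positivity)
    _ = ε * K.card * T.card := by ring
end

section
/- Let P_V be a probability distribution on a finite alphabet 𝒱 all of whose values lie in the set {k/N : k = 0,…,N}, so that P_V ∈ 𝒬. Let 𝐕 = (V_1,…,V_N) be distributed according to the i.i.d. product (P_V)^{⊗N} and let Q = freq(𝐕). Then the distribution P_Q of Q attains its maximum at P_V, i.e., P_Q(P_V) = max_{q ∈ 𝒬} P_Q(q). -/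
open scoped Classical
open Finset

open scoped Nat

/-- Moving an exponent `c` to `k` costs at most the ratio of the factorials. -/
lemma pow_mul_factorial_le_pow_self_mul_factorial (k c : ℕ) :
    k ^ c * k ! ≤ k ^ k * c ! := by
  rcases le_total k c with h | h
  · calc k ^ c * k ! = k ^ k * (k ! * k ^ (c - k)) := by
          rw [← Nat.add_sub_cancel' h, pow_add, Nat.add_sub_cancel_left]; ring
      _ ≤ k ^ k * c ! := Nat.mul_le_mul_left _ (Nat.factorial_mul_pow_sub_le_factorial h)
  · calc k ^ c * k ! ≤ k ^ c * (c ! * k ^ (k - c)) :=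
          Nat.mul_le_mul_left _ (by
            rw [← Nat.factorial_mul_descFactorial (Nat.sub_le k c), Nat.sub_sub_self h]
            exact Nat.mul_le_mul_left _ (Nat.descFactorial_le_pow k (k - c)))
      _ = k ^ k * c ! := by
          rw [mul_left_comm, ← pow_add, Nat.add_sub_cancel' h, mul_comm]

/-- Two maps from a finite type whose fibres have equal sizes differ by a permutation. -/
lemma exists_perm_comp_eq {α V : Type*} [Fintype α] [DecidableEq V] {v w : α → V}
    (h : ∀ u, #{n | v n = u} = #{n | w n = u}) :
    ∃ g : Equiv.Perm α, w ∘ g = v := by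
  have e : ∀ u, Nonempty ({n // v n = u} ≃ {n // w n = u}) := fun u =>
    Fintype.card_eq.mp (by rw [Fintype.card_subtype, Fintype.card_subtype, h u])
  refine ⟨Equiv.ofFiberEquiv fun u => (e u).some, ?_⟩
  ext n
  exact Equiv.ofFiberEquiv_map _ n

/-- The number of maps with the same fibre sizes as `w` is a multinomial coefficient. -/
lemma card_same_fibers_mul_prod_factorial {α V : Type*} [Fintype α] [DecidableEq α]
    [Fintype V] [DecidableEq V] (w : α → V) :
    #{v : α → V | ∀ u, #{n | v n = u} = #{n | w n = u}} * ∏ u, (#{n | w n = u})!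
      = (Fintype.card α)! := by
  have hmaps : ∀ g ∈ (univ : Finset (Equiv.Perm α)),
      w ∘ g ∈ ({v : α → V | ∀ u, #{n | v n = u} = #{n | w n = u}} : Finset (α → V)) := by
    intro g _
    simp only [mem_filter, mem_univ, true_and]
    intro u
    exact card_equiv g (by simp)
  rw [← Fintype.card_perm, ← card_univ, card_eq_sum_card_fiberwise hmaps, sum_const_nat]
  intro v hv
  simp only [mem_filter, mem_univ, true_and] at hv
  obtain ⟨g₀, hg₀⟩ := exists_perm_comp_eq hv
  have hstab := DomMulAct.stabilizer_card (f := v)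
  simp only [Fintype.card_subtype, hv] at hstab
  rw [← hstab]
  refine card_equiv (Equiv.mulLeft g₀⁻¹) fun g => ?_
  simp only [mem_filter, mem_univ, true_and, Equiv.coe_mulLeft]
  rw [← hg₀, Function.comp_assoc, ← Equiv.Perm.coe_mul, mul_inv_cancel_left]

/-- Prescribed fibre sizes that add up to `N` are realised by a string of length `N`. -/
lemma exists_string_with_counts {V : Type*} [Fintype V] [DecidableEq V] {N : ℕ} (k : V → ℕ)
    (hk : ∑ u, k u = N) : ∃ w : Fin N → V, ∀ u, #{n | w n = u} = k u := by
  have e : (Σ u, Fin (k u)) ≃ Fin N := Fintype.equivFinOfCardEq (by simp [hk])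
  refine ⟨fun n => (e.symm n).1, fun u => ?_⟩
  rw [← Fintype.card_subtype, Fintype.card_congr
    ((e.symm.subtypeEquiv (fun _ => Iff.rfl)).trans (Equiv.sigmaSubtype u)), Fintype.card_fin]

lemma freq_eq_freq_iff {V : Type*} [Fintype V] [DecidableEq V] {N : ℕ} (hN : 1 ≤ N)
    (v w : Fin N → V) : freq v = freq w ↔ ∀ u, #{n | v n = u} = #{n | w n = u} := by
  have hN' : (N : ℝ) ≠ 0 := by positivity
  simp only [funext_iff, freq, div_left_inj' hN', Nat.cast_inj]

/-- The probability of the type class of `w` under the i.i.d. law `k / N`. -/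
lemma sum_freq_class_mul_prod_factorial {V : Type*} [Fintype V] [DecidableEq V] {N : ℕ}
    (hN : 1 ≤ N) (k : V → ℕ) (w : Fin N → V) :
    (∑ v ∈ Finset.univ.filter (fun v : Fin N → V => freq v = freq w),
        ∏ n, (k (v n) : ℝ) / N) * ∏ u, ((#{n | w n = u})! : ℝ)
      = N ! / (N : ℝ) ^ N * ∏ u, (k u : ℝ) ^ #{n | w n = u} := by
  have hconst : ∀ v ∈ Finset.univ.filter (fun v : Fin N → V => freq v = freq w),
      ∏ n, (k (v n) : ℝ) / N = (∏ u, (k u : ℝ) ^ #{n | w n = u}) / (N : ℝ) ^ N := by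
    intro v hv
    rw [mem_filter, freq_eq_freq_iff hN] at hv
    rw [prod_div_distrib, prod_const, card_univ, Fintype.card_fin,
      ← prod_fiberwise' univ v fun u => (k u : ℝ)]
    simp only [prod_const, hv.2]
  have hcard := card_same_fibers_mul_prod_factorial w
  simp only [← freq_eq_freq_iff hN, Fintype.card_fin] at hcard
  rw [sum_congr rfl hconst, sum_const, nsmul_eq_mul, ← hcard]
  push_cast
  ring

/-- If `P_V` is a distribution on `𝒱` all of whose values lie in `{k/N : k = 0,…,N}`
(so that `P_V ∈ 𝒬`), and `𝐕 = (V_1,…,V_N)` is i.i.d. with single-copy law `P_V`, then the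
distribution `P_Q` of `Q = freq(𝐕)` attains its maximum at `P_V`. -/
theorem freq_distribution_max_at_iid_law
    {V : Type*} [Fintype V] [DecidableEq V] (N : ℕ) (hN : 1 ≤ N)
    (p : V → ℝ) (hp0 : ∀ u, 0 ≤ p u) (hp1 : ∑ u, p u = 1)
    (hval : ∀ u, ∃ k : ℕ, k ≤ N ∧ p u = (k : ℝ) / N) :
    p ∈ Set.range (freq (V := V) (N := N)) ∧
    ∀ q ∈ Set.range (freq (V := V) (N := N)),
      (∑ v ∈ Finset.univ.filter (fun v : Fin N → V => freq v = q), ∏ n, p (v n))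
        ≤ ∑ v ∈ Finset.univ.filter (fun v : Fin N → V => freq v = p), ∏ n, p (v n) := by
  have hN' : (N : ℝ) ≠ 0 := by positivity
  choose k _ hk using hval
  obtain rfl : p = fun u => (k u : ℝ) / N := funext hk
  have hsum : ∑ u, k u = N := by
    rw [← sum_div, div_eq_one_iff_eq hN'] at hp1
    exact_mod_cast hp1
  obtain ⟨w, hw⟩ := exists_string_with_counts k hsum
  have hfw : freq w = fun u => (k u : ℝ) / N := by
    funext u
    simp only [freq, hw]
  refine ⟨⟨w, hfw⟩, ?_⟩
  rintro _ ⟨z, rfl⟩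
  rw [← hfw]
  have hz := sum_freq_class_mul_prod_factorial hN k z
  have hw' := sum_freq_class_mul_prod_factorial hN k w
  simp only [hw] at hw'
  have hineq : (∏ u, (k u : ℝ) ^ #{n | z n = u}) * ∏ u, ((k u)! : ℝ)
      ≤ (∏ u, (k u : ℝ) ^ k u) * ∏ u, ((#{n | z n = u})! : ℝ) := by
    rw [← prod_mul_distrib, ← prod_mul_distrib]
    refine prod_le_prod (fun _ _ => by positivity) fun u _ => ?_
    exact_mod_cast pow_mul_factorial_le_pow_self_mul_factorial (k u) _
  have hpos : 0 < (∏ u, ((#{n | z n = u})! : ℝ)) * ∏ u, ((k u)! : ℝ) :=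
    mul_pos (prod_pos fun _ _ => by positivity) (prod_pos fun _ _ => by positivity)
  refine le_of_mul_le_mul_right ?_ hpos
  rw [hfw] at hw' ⊢
  rw [← mul_assoc, hz, mul_comm (∏ u, ((#{n | z n = u})! : ℝ)), ← mul_assoc, hw',
    mul_assoc, mul_assoc]
  exact mul_le_mul_of_nonneg_left hineq (by positivity)
end

section
/- Let P(a,b|x,y) be any nonsignaling bipartite conditional distribution with outputs a,b ∈ {0,1} and inputs x,y ∈ {0,…,M−1}. Then for each a ∈ {0,1}, Alice's marginal satisfies P_{A|X}(a|0) = β_a · P, where P_{A|X}(a|0) = Σ_b P(a,b|0,y) (independent of y by nonsignaling). -/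
open scoped Classical
open Finset

set_option linter.unusedVariables false

/-- The set `S` of input pairs: `y = x` or `y = x + 1 (mod M)`. -/
def Sprop {M : ℕ} [NeZero M] (x y : Fin M) : Prop := y = x ∨ y = x + 1

/-- The vector `μ`, indexed by tuples `(a,b,x,y)`. -/
noncomputable def μv (M : ℕ) [NeZero M] (a b : Fin 2) (x y : Fin M) : ℝ :=
  if Sprop x y then 1 / (4 * M) else 0

/-- The vector `ν`, indexed by tuples `(a,b,x,y)`. -/
noncomputable def νv (M : ℕ) [NeZero M] (a b : Fin 2) (x y : Fin M) : ℝ :=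
  if ((x : ℕ) = 0 ∧ (y : ℕ) = 0) ∨ ((y : ℕ) = (x : ℕ) + 1) then
    (1 / 4) * ((-1 : ℝ) ^ (a : ℕ) - (-1 : ℝ) ^ (b : ℕ))
  else if y = x ∧ 1 ≤ (x : ℕ) then
    -(1 / 4) * ((-1 : ℝ) ^ (a : ℕ) - (-1 : ℝ) ^ (b : ℕ))
  else if (x : ℕ) = M - 1 ∧ (y : ℕ) = 0 then
    (1 / 4) * ((-1 : ℝ) ^ (a : ℕ) + (-1 : ℝ) ^ (b : ℕ))
  else 0

/-- The vector `β_a = μ + (-1)^a ν`, evaluated at index tuple `(a',b,x,y)`. -/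
noncomputable def βa (M : ℕ) [NeZero M] (a : Fin 2) (a' b : Fin 2) (x y : Fin M) : ℝ :=
  μv M a' b x y + (-1 : ℝ) ^ (a : ℕ) * νv M a' b x y

/-- The sign attached to an input: `1` at `0`, and `-1` elsewhere. -/
noncomputable def inputSign {M : ℕ} [NeZero M] (x : Fin M) : ℝ := if (x : ℕ) = 0 then 1 else -1

lemma fin_ne_add_one {M : ℕ} [NeZero M] (hM : 2 ≤ M) (x : Fin M) : x ≠ x + 1 := by
  intro h
  have h1 : (1 : Fin M) = 0 := left_eq_add.mp h
  have h2 := congrArg Fin.val h1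
  rw [Fin.val_one', Fin.val_zero, Nat.mod_eq_of_lt hM] at h2
  exact one_ne_zero h2

lemma fin_val_add_one_cases {M : ℕ} [NeZero M] (hM : 2 ≤ M) (x : Fin M) :
    (((x + 1 : Fin M) : ℕ) = x + 1 ∧ (x : ℕ) + 1 < M) ∨
      (((x + 1 : Fin M) : ℕ) = 0 ∧ (x : ℕ) + 1 = M) := by
  have h : ((x + 1 : Fin M) : ℕ) = ((x : ℕ) + 1) % M := by
    rw [Fin.val_add, Fin.val_one', Nat.mod_eq_of_lt hM]
  rcases (show (x : ℕ) + 1 < M ∨ (x : ℕ) + 1 = M by omega) with h1 | h1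
  · exact Or.inl ⟨by rw [h, Nat.mod_eq_of_lt h1], h1⟩
  · exact Or.inr ⟨by rw [h, h1, Nat.mod_self], h1⟩

lemma fin_eq_add_one_iff {M : ℕ} [NeZero M] (hM : 2 ≤ M) (x y : Fin M) :
    y = x + 1 ↔ (y : ℕ) = x + 1 ∨ ((x : ℕ) = M - 1 ∧ (y : ℕ) = 0) := by
  rw [Fin.ext_iff]
  have := fin_val_add_one_cases hM x
  omega

lemma βa_eq_ite_add_ite {M : ℕ} [NeZero M] (hM : 2 ≤ M) (a a' b : Fin 2) (x y : Fin M) :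
    βa M a a' b x y =
      (if y = x then 1 / (4 * (M : ℝ)) + (-1 : ℝ) ^ (a : ℕ) *
        (inputSign x / 4 * ((-1) ^ (a' : ℕ) - (-1) ^ (b : ℕ))) else 0) +
      (if y = x + 1 then 1 / (4 * (M : ℝ)) + (-1 : ℝ) ^ (a : ℕ) *
        (1 / 4 * ((-1) ^ (a' : ℕ) + inputSign y * (-1) ^ (b : ℕ))) else 0) := by
  have hne := fin_ne_add_one hM x
  have hiff := fin_eq_add_one_iff hM x y
  unfold βa μv νv Sprop inputSign
  by_cases h1 : y = x
  · subst h1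
    by_cases h0 : (y : ℕ) = 0
    · simp [h0, hne]
    · have : 1 ≤ (y : ℕ) := by omega
      simp [h0, hne, this]
      ring
  · by_cases h2 : y = x + 1
    · by_cases h3 : (y : ℕ) = (x : ℕ) + 1
      · rw [if_pos (Or.inr h2), if_pos (Or.inr h3), if_neg h1, if_pos h2, if_neg (by omega)]
        ring
      · have h4 : (x : ℕ) = M - 1 ∧ (y : ℕ) = 0 := (hiff.mp h2).resolve_left h3
        rw [if_pos (Or.inr h2), if_neg (by omega), if_neg (by tauto), if_pos h4, if_neg h1,
          if_pos h2, if_pos h4.2]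
        ring
    · have h3 := mt hiff.mpr h2
      rw [if_neg (by tauto), if_neg (by omega), if_neg (by tauto), if_neg (by tauto), if_neg h1,
        if_neg h2]
      ring

/-- Lemma 5 of the paper for a single pair (`N = 1`): for any nonsignaling bipartite
conditional distribution `P(a,b|x,y)`, Alice's marginal for input `x = 0` equals the dot
product `β_a · P`. -/
theorem alice_marginal_eq_beta_dot
    (M : ℕ) [NeZero M] (hM : 2 ≤ M)
    (P : Fin 2 → Fin 2 → Fin M → Fin M → ℝ)
    (hpos : ∀ a b x y, 0 ≤ P a b x y)
    (hnorm : ∀ x y, ∑ a, ∑ b, P a b x y = 1)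
    (nsA : ∀ (b : Fin 2) (y x x' : Fin M), ∑ a, P a b x y = ∑ a, P a b x' y)
    (nsB : ∀ (a : Fin 2) (x y y' : Fin M), ∑ b, P a b x y = ∑ b, P a b x y') :
    ∀ (a : Fin 2) (y : Fin M),
      ∑ b, P a b 0 y
        = ∑ a' : Fin 2, ∑ b : Fin 2, ∑ x : Fin M, ∑ y' : Fin M,
            βa M a a' b x y' * P a' b x y' := by
  intro a y
  set A : Fin M → ℝ := fun x => ∑ b, P 0 b x 0 - ∑ b, P 1 b x 0 with hA
  set B : Fin M → ℝ := fun y => ∑ a, P a 0 0 y - ∑ a, P a 1 0 y with hB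
  have alice : ∀ x y, P 0 0 x y + P 0 1 x y - P 1 0 x y - P 1 1 x y = A x := by
    intro x y
    simp only [hA]
    rw [nsB 0 x 0 y, nsB 1 x 0 y]
    simp only [Fin.sum_univ_two]
    ring
  have bob : ∀ x y, P 0 0 x y - P 0 1 x y + P 1 0 x y - P 1 1 x y = B y := by
    intro x y
    simp only [hB]
    rw [nsA 0 y 0 x, nsA 1 y 0 x]
    simp only [Fin.sum_univ_two]
    ring
  have norm : ∀ x y, P 0 0 x y + P 0 1 x y + P 1 0 x y + P 1 1 x y = 1 := by
    intro x y
    rw [← hnorm x y]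
    simp only [Fin.sum_univ_two]
    ring
  have row : ∀ x, ∑ a' : Fin 2, ∑ b : Fin 2, ∑ y', βa M a a' b x y' * P a' b x y' =
      1 / (2 * (M : ℝ)) + (-1 : ℝ) ^ (a : ℕ) / 4 * ((inputSign x + 1) * A x +
        (inputSign (x + 1) * B (x + 1) - inputSign x * B x)) := by
    intro x
    simp only [βa_eq_ite_add_ite hM, add_mul, ite_mul, zero_mul, Finset.sum_add_distrib,
      Finset.sum_ite_eq', Finset.mem_univ, if_true, Fin.sum_univ_two, Fin.val_zero,
      Fin.val_one, pow_zero, pow_one]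
    linear_combination (1 / (4 * (M : ℝ))) * (norm x x + norm x (x + 1)) +
      (-1 : ℝ) ^ (a : ℕ) / 4 * (inputSign x * (alice x x - bob x x) + alice x (x + 1) +
        inputSign (x + 1) * bob x (x + 1))
  have shift : ∑ x, inputSign (x + 1) * B (x + 1) = ∑ x, inputSign x * B x :=
    Equiv.sum_comp (Equiv.addRight (1 : Fin M)) fun x => inputSign x * B x
  have diag : ∑ x, (inputSign x + 1) * A x = 2 * A 0 := by
    rw [Finset.sum_eq_single 0]
    · norm_num [inputSign]
    · intro x _ hx
      have : (x : ℕ) ≠ 0 := fun h => hx (Fin.ext h)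
      simp [inputSign, this]
    · simp
  have hM0 : (M : ℝ) ≠ 0 := NeZero.ne _
  have total : ∑ a' : Fin 2, ∑ b : Fin 2, ∑ x : Fin M, ∑ y' : Fin M,
      βa M a a' b x y' * P a' b x y' = 1 / 2 + (-1 : ℝ) ^ (a : ℕ) / 2 * A 0 := by
    have swap : ∑ a' : Fin 2, ∑ b : Fin 2, ∑ x : Fin M, ∑ y' : Fin M,
        βa M a a' b x y' * P a' b x y' =
        ∑ x, ∑ a' : Fin 2, ∑ b : Fin 2, ∑ y', βa M a a' b x y' * P a' b x y' := by
      simp only [Fin.sum_univ_two, Finset.sum_add_distrib]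
    rw [swap, Finset.sum_congr rfl fun x _ => row x, Finset.sum_add_distrib, ← Finset.mul_sum,
      Finset.sum_add_distrib, Finset.sum_sub_distrib, shift, diag, Finset.sum_const,
      Finset.card_univ, Fintype.card_fin, nsmul_eq_mul]
    field_simp
    ring
  rw [total, ← alice 0 y]
  fin_cases a <;> simp <;> linarith [norm 0 y]
end

section
/- The vector β is invariant under every cyclic relabeling of the inputs: for every m ∈ {0,…,M−1} and all a,b ∈ {0,1}, x,y ∈ {0,…,M−1}, β(a ⊕ [M−m ≤ x ≤ M−1], b ⊕ [M−m ≤ y ≤ M−1], (x+m) mod M, (y+m) mod M) = β(a,b,x,y). -/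
open scoped Classical
open Finset

set_option linter.unusedVariables false

/-- The vector `β = μ + |ν|`, indexed by tuples `(a,b,x,y)`. -/
noncomputable def βv (M : ℕ) [NeZero M] (a b : Fin 2) (x y : Fin M) : ℝ :=
  μv M a b x y + |νv M a b x y|

theorem sprop_add_right_iff {M : ℕ} [NeZero M] (x y m : Fin M) :
    Sprop (x + m) (y + m) ↔ Sprop x y := by
  simp only [Sprop, add_left_inj, add_right_comm x m 1]

theorem abs_νv (M : ℕ) [NeZero M] (a b : Fin 2) (x y : Fin M) :
    |νv M a b x y| =
      if (y : ℕ) = x ∨ (y : ℕ) = x + 1 then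
        (1 / 4) * |(-1 : ℝ) ^ (a : ℕ) - (-1 : ℝ) ^ (b : ℕ)|
      else if (x : ℕ) = M - 1 ∧ (y : ℕ) = 0 then
        (1 / 4) * |(-1 : ℝ) ^ (a : ℕ) + (-1 : ℝ) ^ (b : ℕ)|
      else 0 := by
  unfold νv
  simp only [Fin.ext_iff]
  split_ifs <;> first | omega | simp [abs_mul]

theorem neg_one_pow_fin_two_add_ite (p : Prop) [Decidable p] (a : Fin 2) :
    (-1 : ℝ) ^ ((a + if p then 1 else 0 : Fin 2) : ℕ) =
      if p then -(-1 : ℝ) ^ (a : ℕ) else (-1 : ℝ) ^ (a : ℕ) := by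
  split_ifs
  · fin_cases a <;> simp
  · simp

theorem abs_νv_relabel {M : ℕ} [NeZero M] (hM : 2 ≤ M) (m : Fin M) (a b : Fin 2)
    (x y : Fin M) :
    |νv M (a + if M - (m : ℕ) ≤ (x : ℕ) then 1 else 0)
        (b + if M - (m : ℕ) ≤ (y : ℕ) then 1 else 0) (x + m) (y + m)| =
      |νv M a b x y| := by
  have hx := x.isLt
  have hy := y.isLt
  have hm := m.isLt
  have abs_neg_sub (s t : ℝ) : |-s - t| = |s + t| := by
    rw [← abs_neg]; congr 1; ring
  have abs_neg_add (s t : ℝ) : |-s + t| = |s - t| := by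
    rw [← abs_neg]; congr 1; ring
  rw [abs_νv, abs_νv, neg_one_pow_fin_two_add_ite, neg_one_pow_fin_two_add_ite]
  simp only [Fin.val_add_eq_ite, tsub_le_iff_right]
  by_cases h₁ : M ≤ (x : ℕ) + m <;> by_cases h₂ : M ≤ (y : ℕ) + m <;>
    simp only [h₁, h₂, if_true, if_false, abs_neg_sub,
      abs_neg_add, sub_neg_eq_add, ← sub_eq_add_neg] <;>
    split_ifs <;> first | rfl | omega

/-- The vector `β` is invariant under every cyclic relabeling of the inputs. -/
theorem beta_invariant_under_relabeling
    (M : ℕ) [NeZero M] (hM : 2 ≤ M) :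
    ∀ (m : Fin M) (a b : Fin 2) (x y : Fin M),
      βv M (a + if M - (m : ℕ) ≤ (x : ℕ) then 1 else 0)
            (b + if M - (m : ℕ) ≤ (y : ℕ) then 1 else 0)
            (x + m) (y + m)
        = βv M a b x y := by
  intro m a b x y
  simp only [βv, μv, sprop_add_right_iff, abs_νv_relabel hM]
end

section
/- Let P(𝐚,𝐛,e|𝐱,𝐲,z) be any (2N+1)-partite nonsignaling conditional distribution. For every 𝐱 ∈ {0,…,M−1}^N, Eve's optimal guessing probability of Alice's outcomes satisfies 𝒫_guess(𝐀|E,𝐱) := max_z Σ_e max_𝐚 P_{𝐀,E|𝐗,Z}(𝐚,e|𝐱,z) ≤ ⟨ℬ_1⋯ℬ_N⟩, where P_{𝐀,E|𝐗,Z}(𝐚,e|𝐱,z) = Σ_𝐛 P(𝐚,𝐛,e|𝐱,𝐲,z) (independent of 𝐲 by nonsignaling). -/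
open scoped Classical
open Finset

set_option linter.unusedVariables false

/-- The Braunstein–Caves random variable `ℬ(a,b,x,y) = 1/2 + M·(a ⊕ b ⊕ [x=M-1][y=0])`. -/
noncomputable def BC (M : ℕ) [NeZero M] (a b : Fin 2) (x y : Fin M) : ℝ :=
  1 / 2 + M * ((((a : ℕ) + (b : ℕ) +
    (if (x : ℕ) = M - 1 ∧ (y : ℕ) = 0 then 1 else 0)) % 2 : ℕ) : ℝ)

/-- A sum over pair-valued functions is a double sum over the component functions. -/
theorem sum_fun_prod {ι α β : Type*} [Fintype ι] [DecidableEq ι] [Fintype α] [Fintype β]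
    (F : (ι → α × β) → ℝ) :
    ∑ t, F t = ∑ a : ι → α, ∑ b : ι → β, F fun i => (a i, b i) := by
  rw [← Fintype.sum_prod_type' (fun (a : ι → α) (b : ι → β) => F fun i => (a i, b i))]
  exact Fintype.sum_equiv (Equiv.arrowProdEquivProdArrow ι (fun _ => α) (fun _ => β)) _ _
    fun _ => rfl

/-- To compare two sums over functions it suffices to compare them along every coordinate line. -/
theorem sum_le_sum_of_update {ι T : Type*} [Fintype ι] [DecidableEq ι] [Fintype T] [Nonempty T] (n : ι)
    (F G : (ι → T) → ℝ)
    (h : ∀ t : ι → T, ∑ s, F (Function.update t n s) ≤ ∑ s, G (Function.update t n s)) :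
    ∑ t, F t ≤ ∑ t, G t := by
  have split : ∀ H : (ι → T) → ℝ, ∑ t, H t = ∑ r : {j // j ≠ n} → T, ∑ s,
      H (Function.update ((Equiv.funSplitAt n T).symm (Classical.arbitrary T, r)) n s) := by
    intro H
    rw [Finset.sum_comm, ← Fintype.sum_prod_type' (fun (s : T) (r : {j // j ≠ n} → T) =>
      H (Function.update ((Equiv.funSplitAt n T).symm (Classical.arbitrary T, r)) n s))]
    refine Fintype.sum_equiv (Equiv.funSplitAt n T) _ _ fun t => ?_
    congr 1
    ext j
    by_cases hj : j = n
    · subst hj; simp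
    · simp [hj]
  rw [split F, split G]
  exact Finset.sum_le_sum fun r _ => h _

/-- Inequalities between nonnegative weights that hold for `Q` in each coordinate separately
pass to the product weights. -/
theorem sum_prod_mul_le_of_coord {ι T : Type*} [Fintype ι] [DecidableEq ι] [Fintype T] [Nonempty T]
    (c d : ι → T → ℝ) (hc : ∀ n s, 0 ≤ c n s) (hd : ∀ n s, 0 ≤ d n s) (Q : (ι → T) → ℝ)
    (h : ∀ n t, ∑ s, d n s * Q (Function.update t n s) ≤ ∑ s, c n s * Q (Function.update t n s)) :
    ∑ t, (∏ n, d n (t n)) * Q t ≤ ∑ t, (∏ n, c n (t n)) * Q t := by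
  have key : ∀ S : Finset ι, ∑ t : ι → T, (∏ n, d n (t n)) * Q t ≤
      ∑ t : ι → T, (∏ n, if n ∈ S then c n (t n) else d n (t n)) * Q t := by
    intro S
    induction S using Finset.induction_on with
    | empty => simp
    | insert n S hn ih =>
      refine ih.trans (sum_le_sum_of_update n _ _ fun t => ?_)
      have hw : ∀ s, (∏ m ∈ univ.erase n, if m ∈ S then c m (Function.update t n s m)
          else d m (Function.update t n s m)) =
          ∏ m ∈ univ.erase n, if m ∈ S then c m (t m) else d m (t m) := fun s =>
        Finset.prod_congr rfl fun m hm => by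
          rw [Function.update_of_ne (Finset.ne_of_mem_erase hm)]
      have hw' : ∀ s, (∏ m ∈ univ.erase n, if m ∈ insert n S then c m (Function.update t n s m)
          else d m (Function.update t n s m)) =
          ∏ m ∈ univ.erase n, if m ∈ S then c m (t m) else d m (t m) := fun s =>
        Finset.prod_congr rfl fun m hm => by
          rw [Function.update_of_ne (Finset.ne_of_mem_erase hm)]
          simp [Finset.mem_insert, Finset.ne_of_mem_erase hm]
      simp_rw [← Finset.mul_prod_erase univ _ (Finset.mem_univ n), hw, hw']
      simp only [hn, if_false, Finset.mem_insert_self, if_true, Function.update_self]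
      have hnn : 0 ≤ ∏ m ∈ univ.erase n, if m ∈ S then c m (t m) else d m (t m) :=
        Finset.prod_nonneg fun m _ => by split_ifs; exacts [hc _ _, hd _ _]
      simp_rw [mul_right_comm _ (∏ m ∈ univ.erase n, if m ∈ S then c m (t m) else d m (t m)),
        ← Finset.sum_mul]
      exact mul_le_mul_of_nonneg_right (h n t) hnn
  simpa using key univ

/-- Triangle inequality along the zigzag `β 0, α 0, β 1, α 1, …, β M`, pinned at `α k`. -/
theorem abs_add_abs_le_sum_zigzag (α β : ℕ → ℝ) {k M : ℕ} (hk : k < M) :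
    |α k - β 0| + |α k - β M| ≤ ∑ i ∈ range M, (|α i - β i| + |α i - β (i + 1)|) := by
  have hI : ∀ m n, m ≤ n →
      |β m - β n| ≤ ∑ i ∈ Ico m n, (|α i - β i| + |α i - β (i + 1)|) := by
    intro m n hmn
    have h1 := dist_le_Ico_sum_dist β hmn
    rw [Real.dist_eq] at h1
    refine h1.trans (Finset.sum_le_sum fun i _ => ?_)
    rw [Real.dist_eq, abs_sub_comm (α i) (β i)]
    exact abs_sub_le _ _ _
  have h1 := hI 0 k (Nat.zero_le k)
  have h2 := hI (k + 1) M hk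
  rw [← Finset.range_eq_Ico] at h1
  rw [← Finset.sum_range_add_sum_Ico _ hk, Finset.sum_range_succ]
  have h3 := abs_sub_le (α k) (β k) (β 0)
  have h4 := abs_sub_le (α k) (β (k + 1)) (β M)
  rw [abs_sub_comm (β k)] at h3
  linarith

theorem BC_nonneg (M : ℕ) [NeZero M] (a b : Fin 2) (x y : Fin M) : 0 ≤ BC M a b x y := by
  unfold BC; positivity

/-- The joint weight of a single pair: uniform on `Sprop` times the Braunstein–Caves variable. -/
noncomputable def BCWeight (M : ℕ) [NeZero M] (a b : Fin 2) (x y : Fin M) : ℝ :=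
  if Sprop x y then 1 / (2 * (M : ℝ)) * BC M a b x y else 0

theorem BCWeight_nonneg (M : ℕ) [NeZero M] (a b : Fin 2) (x y : Fin M) :
    0 ≤ BCWeight M a b x y := by
  unfold BCWeight
  have := BC_nonneg M a b x y
  split_ifs <;> positivity

/-- The bound for one pair of parties and an unnormalized nonsignaling distribution. -/
theorem marginal_le_sum_BCWeight {M : ℕ} [NeZero M] (hM : 2 ≤ M)
    (q : Fin 2 → Fin 2 → Fin M → Fin M → ℝ) (hq : ∀ a b x y, 0 ≤ q a b x y)
    (hqA : ∀ b x x' y, q 0 b x y + q 1 b x y = q 0 b x' y + q 1 b x' y)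
    (hqB : ∀ a x y y', q a 0 x y + q a 1 x y = q a 0 x y' + q a 1 x y')
    (a₀ : Fin 2) (x₀ : Fin M) :
    ∑ b, q a₀ b x₀ 0 ≤ ∑ a, ∑ b, ∑ x, ∑ y, BCWeight M a b x y * q a b x y := by
  have hM0 : (0 : ℝ) < M := by exact_mod_cast (by omega : 0 < M)
  obtain ⟨A, hA⟩ : ∃ A : Fin M → ℝ, ∀ x y, q 1 0 x y + q 1 1 x y = A x :=
    ⟨fun x => q 1 0 x 0 + q 1 1 x 0, fun x y => hqB 1 x y 0⟩
  obtain ⟨B, hB⟩ : ∃ B : Fin M → ℝ, ∀ x y, q 0 1 x y + q 1 1 x y = B y :=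
    ⟨fun y => q 0 1 0 y + q 1 1 0 y, fun x y => hqA 1 x 0 y⟩
  obtain ⟨W, hW⟩ : ∃ W : ℝ, ∀ x y, q 0 0 x y + q 0 1 x y + q 1 0 x y + q 1 1 x y = W :=
    ⟨q 0 0 0 0 + q 0 1 0 0 + q 1 0 0 0 + q 1 1 0 0, fun x y => by
      linarith [hqB 0 x y 0, hqB 1 x y 0, hqA 0 x 0 0, hqA 1 x 0 0]⟩
  set V : Fin M → Fin M → ℝ := fun x y => ∑ a, ∑ b, BC M a b x y * q a b x y with hV
  have hV0 : ∀ x y : Fin M, ¬ ((x : ℕ) = M - 1 ∧ (y : ℕ) = 0) →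
      W / 2 + M * |A x - B y| ≤ V x y := by
    intro x y hxy
    have : V x y = W / 2 + M * (q 0 1 x y + q 1 0 x y) := by
      simp only [hV, BC, Fin.sum_univ_two, if_neg hxy, ← hW x y]
      norm_num
      ring
    rw [this]
    have : |A x - B y| ≤ q 0 1 x y + q 1 0 x y := by
      rw [← hA x y, ← hB x y]
      exact abs_le.2 ⟨by linarith [hq 1 0 x y], by linarith [hq 0 1 x y]⟩
    gcongr
  have hV1 : ∀ x y : Fin M, ((x : ℕ) = M - 1 ∧ (y : ℕ) = 0) →
      W / 2 + M * |A x - (W - B y)| ≤ V x y := by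
    intro x y hxy
    have : V x y = W / 2 + M * (q 0 0 x y + q 1 1 x y) := by
      simp only [hV, BC, Fin.sum_univ_two, if_pos hxy, ← hW x y]
      norm_num
      ring
    rw [this]
    have : |A x - (W - B y)| ≤ q 0 0 x y + q 1 1 x y := by
      rw [← hA x y, ← hB x y, ← hW x y]
      exact abs_le.2 ⟨by linarith [hq 1 1 x y], by linarith [hq 0 0 x y]⟩
    gcongr
  have hsum : ∑ a, ∑ b, ∑ x, ∑ y, BCWeight M a b x y * q a b x y =
      1 / (2 * (M : ℝ)) * ∑ x : Fin M, (V x x + V x (x + 1)) := by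
    have h1 : ∑ a, ∑ b, ∑ x, ∑ y, BCWeight M a b x y * q a b x y =
        ∑ x, ∑ y, if Sprop x y then 1 / (2 * (M : ℝ)) * V x y else 0 := by
      simp only [Fin.sum_univ_two, ← Finset.sum_add_distrib]
      refine Finset.sum_congr rfl fun x _ => Finset.sum_congr rfl fun y _ => ?_
      simp only [BCWeight, hV, Fin.sum_univ_two]
      split_ifs <;> ring
    rw [h1, Finset.mul_sum]
    refine Finset.sum_congr rfl fun x _ => ?_
    have hne : x ≠ x + 1 := by simp; omega
    rw [← Finset.sum_filter]
    have hS : univ.filter (fun y => Sprop x y) = {x, x + 1} := by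
      ext y
      rw [Finset.mem_filter]
      simp [Sprop]
    rw [hS, Finset.sum_pair hne]
    ring
  set α : ℕ → ℝ := fun i => A (Fin.ofNat M i)
  set β : ℕ → ℝ := fun i => if i < M then B (Fin.ofNat M i) else W - B 0
  have hx : ∀ x : Fin M, Fin.ofNat M (x : ℕ) = x := fun x => Fin.ofNat_val_eq_self x
  have hα : ∀ x : Fin M, α x = A x := fun x => by simp only [α, hx]
  have hβ : ∀ x : Fin M, β x = B x := fun x => by simp only [β, hx, x.2, if_true]
  have hβM : β M = W - B 0 := by simp [β]
  have hβ0 : β 0 = B 0 := by simpa using hβ 0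
  have hterm : ∀ x : Fin M,
      W + M * (|α x - β x| + |α x - β ((x : ℕ) + 1)|) ≤ V x x + V x (x + 1) := by
    intro x
    have h1 := hV0 x x (by omega)
    rw [hα, hβ]
    by_cases hl : (x : ℕ) + 1 < M
    · have hval : ((x + 1 : Fin M) : ℕ) = (x : ℕ) + 1 := by
        rw [Fin.val_add_one_of_lt' hl]
      have h2 := hV0 x (x + 1) (by omega)
      rw [← hβ (x + 1), hval] at h2
      linarith
    · have hl' : (x : ℕ) + 1 = M := by omega
      have h0 : x + 1 = 0 := by
        apply Fin.ext
        simp [Fin.val_add, hl', Nat.mod_eq_of_lt (by omega : 1 < M)]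
      have h2 := hV1 x (x + 1) ⟨by omega, by simp [h0]⟩
      rw [h0] at h2
      rw [hl', hβM, h0]
      linarith
  have hzig := abs_add_abs_le_sum_zigzag α β x₀.2
  rw [hα, hβ0, hβM, ← Fin.sum_univ_eq_sum_range
    (fun i => |α i - β i| + |α i - β (i + 1)|)] at hzig
  have htot : M * (W + (|A x₀ - B 0| + |A x₀ - (W - B 0)|)) ≤
      ∑ x : Fin M, (V x x + V x (x + 1)) := by
    calc M * (W + (|A x₀ - B 0| + |A x₀ - (W - B 0)|))
        ≤ M * (W + ∑ x : Fin M, (|α x - β x| + |α x - β ((x : ℕ) + 1)|)) := by gcongr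
      _ = ∑ x : Fin M, (W + M * (|α x - β x| + |α x - β ((x : ℕ) + 1)|)) := by
        rw [Finset.sum_add_distrib (f := fun _ => W), ← Finset.mul_sum, mul_add]
        simp
      _ ≤ _ := Finset.sum_le_sum fun x _ => hterm x
  have hW₀ := hW x₀ 0
  have hA₀ := hA x₀ 0
  calc ∑ b, q a₀ b x₀ 0 ≤ 1 / 2 * (W + (|A x₀ - B 0| + |A x₀ - (W - B 0)|)) := by
        have h1 := le_abs_self (A x₀ - B 0)
        have h2 := neg_abs_le (A x₀ - B 0)
        have h3 := le_abs_self (A x₀ - (W - B 0))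
        have h4 := neg_abs_le (A x₀ - (W - B 0))
        rw [Fin.sum_univ_two]
        fin_cases a₀
        · simp only [Fin.zero_eta]
          linarith
        · simp only [Fin.mk_one]
          linarith
    _ = 1 / (2 * (M : ℝ)) * (M * (W + (|A x₀ - B 0| + |A x₀ - (W - B 0)|))) := by
        field_simp
    _ ≤ _ := by
        rw [hsum]
        gcongr

/-- The bound for `N` pairs of parties and an unnormalized nonsignaling distribution. -/
theorem marginal_le_sum_prod_BCWeight {M N : ℕ} [NeZero M] (hM : 2 ≤ M)
    (Q : (Fin N → Fin 2) → (Fin N → Fin 2) → (Fin N → Fin M) → (Fin N → Fin M) → ℝ)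
    (hQ : ∀ a b x y, 0 ≤ Q a b x y)
    (hQA : ∀ (n : Fin N) (a b : Fin N → Fin 2) (x x' y : Fin N → Fin M),
      (∀ m, m ≠ n → x m = x' m) →
      ∑ v : Fin 2, Q (Function.update a n v) b x y = ∑ v : Fin 2, Q (Function.update a n v) b x' y)
    (hQB : ∀ (n : Fin N) (a b : Fin N → Fin 2) (x y y' : Fin N → Fin M),
      (∀ m, m ≠ n → y m = y' m) →
      ∑ v : Fin 2, Q a (Function.update b n v) x y = ∑ v : Fin 2, Q a (Function.update b n v) x y')
    (a₀ : Fin N → Fin 2) (x₀ : Fin N → Fin M) :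
    ∑ b, Q a₀ b x₀ (fun _ => 0) ≤
      ∑ a, ∑ b, ∑ x, ∑ y, (∏ n, BCWeight M (a n) (b n) (x n) (y n)) * Q a b x y := by
  let Q' : (Fin N → Fin 2 × Fin 2 × Fin M × Fin M) → ℝ := fun t =>
    Q (fun n => (t n).1) (fun n => (t n).2.1) (fun n => (t n).2.2.1) (fun n => (t n).2.2.2)
  let d : Fin N → Fin 2 × Fin 2 × Fin M × Fin M → ℝ := fun n s =>
    if s.1 = a₀ n ∧ s.2.2.1 = x₀ n ∧ s.2.2.2 = 0 then 1 else 0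
  let c : Fin N → Fin 2 × Fin 2 × Fin M × Fin M → ℝ := fun _ s => BCWeight M s.1 s.2.1 s.2.2.1 s.2.2.2
  have main := sum_prod_mul_le_of_coord c d (fun _ _ => BCWeight_nonneg M _ _ _ _)
    (fun n s => by simp only [d]; split_ifs <;> norm_num) Q' (fun n t => ?_)
  · have hL : ∑ t, (∏ n, d n (t n)) * Q' t = ∑ b, Q a₀ b x₀ (fun _ => 0) := by
      simp_rw [sum_fun_prod]
      have hd : ∀ (a b : Fin N → Fin 2) (x y : Fin N → Fin M),
          (∏ n, d n (a n, b n, x n, y n)) =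
            if y = (fun _ => 0) then (if x = x₀ then (if a = a₀ then 1 else 0) else 0) else 0 := by
        intro a b x y
        simp only [d, Finset.prod_ite_zero, Finset.prod_const_one, ← ite_and, funext_iff]
        refine if_congr ?_ rfl rfl
        simp only [Finset.mem_univ, true_imp_iff, forall_and]
        tauto
      simp_rw [hd, ite_mul, zero_mul, one_mul]
      rw [Finset.sum_comm]
      simp [Q']
    rw [hL] at main
    refine main.trans_eq ?_
    simp_rw [sum_fun_prod]
    rfl
  · let q : Fin 2 → Fin 2 → Fin M → Fin M → ℝ := fun a b x y =>
      Q (Function.update (fun n => (t n).1) n a) (Function.update (fun n => (t n).2.1) n b)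
        (Function.update (fun n => (t n).2.2.1) n x) (Function.update (fun n => (t n).2.2.2) n y)
    have hq' : ∀ a b x y, Q' (Function.update t n (a, b, x, y)) = q a b x y := by
      intro a b x y
      simp only [Q', q]
      congr 1 <;> ext m <;> by_cases hm : m = n <;> (try subst hm) <;> simp [*]
    have hbox := marginal_le_sum_BCWeight hM q (fun _ _ _ _ => hQ _ _ _ _)
      (fun b x x' y => by
        have := hQA n (fun n => (t n).1) (Function.update (fun n => (t n).2.1) n b)
          (Function.update (fun n => (t n).2.2.1) n x)
          (Function.update (fun n => (t n).2.2.1) n x')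
          (Function.update (fun n => (t n).2.2.2) n y) (fun m hm => by simp [hm])
        simpa [Fin.sum_univ_two] using this)
      (fun a x y y' => by
        have := hQB n (Function.update (fun n => (t n).1) n a) (fun n => (t n).2.1)
          (Function.update (fun n => (t n).2.2.1) n x)
          (Function.update (fun n => (t n).2.2.2) n y)
          (Function.update (fun n => (t n).2.2.2) n y') (fun m hm => by simp [hm])
        simpa [Fin.sum_univ_two] using this) (a₀ n) (x₀ n)
    simp only [Fintype.sum_prod_type, hq']
    refine le_of_eq_of_le ?_ hbox
    have hd : ∀ (a b : Fin 2) (x y : Fin M), d n (a, b, x, y) =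
        if y = 0 then (if x = x₀ n then (if a = a₀ n then 1 else 0) else 0) else 0 := by
      intro a b x y
      simp only [d, ← ite_and]
      exact if_congr (by tauto) rfl rfl
    simp_rw [hd, ite_mul, zero_mul, one_mul]
    rw [Finset.sum_comm]
    simp

/-- Lemma 6 of the paper: for any `(2N+1)`-partite nonsignaling conditional distribution
`P(𝐚,𝐛,e|𝐱,𝐲,z)` and any Alice input string `𝐱`, Eve's optimal guessing probability of
Alice's outcome string is bounded by `⟨ℬ₁⋯ℬ_N⟩`, the expectation of the product of the `N`
Braunstein–Caves variables when each input pair `(Xₙ,Yₙ)` is uniform on `S`. -/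
theorem guessing_probability_le_BC
    (M N : ℕ) [NeZero M] (hM : 2 ≤ M) (hN : 1 ≤ N)
    {E Z : Type} [Fintype E] [Fintype Z] [Nonempty Z]
    (P : (Fin N → Fin 2) → (Fin N → Fin 2) → E →
         (Fin N → Fin M) → (Fin N → Fin M) → Z → ℝ)
    (hpos : ∀ a b e x y z, 0 ≤ P a b e x y z)
    (hnorm : ∀ x y z, ∑ a, ∑ b, ∑ e, P a b e x y z = 1)
    (nsA : ∀ (n : Fin N) (a b : Fin N → Fin 2) (e : E) (x x' y : Fin N → Fin M) (z : Z),
      (∀ m, m ≠ n → x m = x' m) →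
      ∑ v : Fin 2, P (Function.update a n v) b e x y z
        = ∑ v : Fin 2, P (Function.update a n v) b e x' y z)
    (nsB : ∀ (n : Fin N) (a b : Fin N → Fin 2) (e : E) (x y y' : Fin N → Fin M) (z : Z),
      (∀ m, m ≠ n → y m = y' m) →
      ∑ v : Fin 2, P a (Function.update b n v) e x y z
        = ∑ v : Fin 2, P a (Function.update b n v) e x y' z)
    (nsE : ∀ a b x y (z z' : Z), ∑ e, P a b e x y z = ∑ e, P a b e x y z') :
    ∀ (x : Fin N → Fin M) (z₀ : Z) (z : Z),
      (∑ e, Finset.univ.sup' Finset.univ_nonempty fun a : Fin N → Fin 2 =>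
          ∑ b, P a b e x (fun _ => 0) z)
      ≤ ∑ a : Fin N → Fin 2, ∑ b : Fin N → Fin 2,
          ∑ x' : Fin N → Fin M, ∑ y : Fin N → Fin M,
            (if ∀ n, Sprop (x' n) (y n) then
                (1 / (2 * (M : ℝ))) ^ N * ∏ n, BC M (a n) (b n) (x' n) (y n)
              else 0)
            * ∑ e, P a b e x' y z₀ := by
  intro x z₀ z
  have hw : ∀ (a b : Fin N → Fin 2) (x' y : Fin N → Fin M),
      (if ∀ n, Sprop (x' n) (y n) then
        (1 / (2 * (M : ℝ))) ^ N * ∏ n, BC M (a n) (b n) (x' n) (y n) else 0) =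
      ∏ n, BCWeight M (a n) (b n) (x' n) (y n) := by
    intro a b x' y
    simp [BCWeight, Finset.prod_ite_zero, Finset.prod_mul_distrib]
  have hR : ∑ a : Fin N → Fin 2, ∑ b : Fin N → Fin 2, ∑ x' : Fin N → Fin M, ∑ y : Fin N → Fin M,
      (∏ n, BCWeight M (a n) (b n) (x' n) (y n)) * ∑ e, P a b e x' y z =
      ∑ e, ∑ a : Fin N → Fin 2, ∑ b : Fin N → Fin 2, ∑ x' : Fin N → Fin M, ∑ y : Fin N → Fin M,
        (∏ n, BCWeight M (a n) (b n) (x' n) (y n)) * P a b e x' y z := by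
    simp only [Finset.mul_sum, Finset.sum_comm (t := (univ : Finset E))]
  simp_rw [hw, nsE _ _ _ _ z₀ z, hR]
  refine Finset.sum_le_sum fun e _ => Finset.sup'_le _ _ fun a _ => ?_
  exact marginal_le_sum_prod_BCWeight hM (fun a b x y => P a b e x y z)
    (fun _ _ _ _ => hpos _ _ _ _ _ _) (fun n a b x x' y h => nsA n a b e x x' y z h)
    (fun n a b x y y' h => nsB n a b e x y y' z h) a x
end

section
/- Let P(a,b,e|x,y,z) be any tripartite nonsignaling conditional distribution with Alice's output a ∈ {0,1} and input x ∈ {0,…,M−1}, Bob's output b ∈ {0,1} and input y ∈ {0,…,M−1}, and Eve's output e and input z in finite sets. Then Eve's optimal probability of guessing Alice's outcome for input x = 0 is bounded by the Braunstein–Caves expectation: max_z Σ_e max_a P_{A,E|X,Z}(a,e|0,z) ≤ ⟨ℬ⟩, where P_{A,E|X,Z}(a,e|0,z) = Σ_b P(a,b,e|0,y,z) (independent of y by nonsignaling) and ⟨ℬ⟩ = Σ_{(x,y) ∈ S} (1/(2M)) Σ_{a,b} ℬ(a,b,x,y) P_AB(a,b|x,y) with P_AB(a,b|x,y) = Σ_e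 P(a,b,e|x,y,z) (independent of z by nonsignaling). -/
open scoped Classical
open Finset

set_option linter.unusedVariables false

/-- Twice the first term of a chain `u 0, v 1, u 1, …, u n, -v 0, -u 0` is bounded by the sum of the
lengths of its steps. -/
theorem two_mul_zero_le_sum_add_sum {n : ℕ} (u v C D : Fin (n + 1) → ℝ)
    (hC : ∀ x, |u x - v x| ≤ C x)
    (hD : ∀ i : Fin n, |u i.castSucc - v i.succ| ≤ D i.castSucc)
    (hlast : |u (Fin.last n) + v 0| ≤ D (Fin.last n)) :
    2 * u 0 ≤ ∑ x, C x + ∑ x, D x := by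
  have hu : ∑ i : Fin n, u i.castSucc + u (Fin.last n) = u 0 + ∑ i : Fin n, u i.succ := by
    rw [← Fin.sum_univ_castSucc, ← Fin.sum_univ_succ]
  have h1 : ∑ i : Fin n, (v i.succ - u i.succ) ≤ ∑ i : Fin n, C i.succ :=
    Finset.sum_le_sum fun i _ => by linarith [neg_le_of_abs_le (hC i.succ)]
  have h2 : ∑ i : Fin n, (u i.castSucc - v i.succ) ≤ ∑ i : Fin n, D i.castSucc :=
    Finset.sum_le_sum fun i _ => le_of_abs_le (hD i)
  rw [Finset.sum_sub_distrib] at h1 h2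
  rw [Fin.sum_univ_succ C, Fin.sum_univ_castSucc D]
  linarith [le_of_abs_le (hC 0), le_of_abs_le hlast]

/-- The bit `a ⊕ b ⊕ [x = M-1][y = 0]`, as a real number. -/
noncomputable def BCbit (M : ℕ) (a b : Fin 2) (x y : Fin M) : ℝ :=
  ((((a : ℕ) + (b : ℕ) + (if (x : ℕ) = M - 1 ∧ (y : ℕ) = 0 then 1 else 0)) % 2 : ℕ) : ℝ)

/-- For a family `Q a b x y` of subnormalized nonsignaling distributions, the larger of the two
marginal weights of Alice at input `0` is bounded by the Braunstein–Caves sum. -/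
theorem two_mul_max_marginal_le {n : ℕ} (hn : 1 ≤ n)
    (Q : Fin 2 → Fin 2 → Fin (n + 1) → Fin (n + 1) → ℝ)
    (hpos : ∀ a b x y, 0 ≤ Q a b x y)
    (nsA : ∀ b x x' y, ∑ a, Q a b x y = ∑ a, Q a b x' y)
    (nsB : ∀ a x y y', ∑ b, Q a b x y = ∑ b, Q a b x y') (y₀ : Fin (n + 1)) :
    2 * max (∑ b, Q 0 b 0 y₀) (∑ b, Q 1 b 0 y₀) ≤
      ∑ a, ∑ b, Q a b 0 0 + ∑ x, ∑ a, ∑ b, BCbit (n + 1) a b x x * Q a b x x +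
        ∑ x, ∑ a, ∑ b, BCbit (n + 1) a b x (x + 1) * Q a b x (x + 1) := by
  set p := ∑ a, ∑ b, Q a b 0 0 with hp
  set u : Fin (n + 1) → ℝ := fun x => ∑ b, Q 0 b x 0 - p / 2 with hu
  set v : Fin (n + 1) → ℝ := fun y => ∑ a, Q a 0 0 y - p / 2 with hv
  have total (x y) : Q 0 0 x y + Q 0 1 x y + (Q 1 0 x y + Q 1 1 x y) = p := by
    have hA0 := nsA 0 x 0 y
    have hA1 := nsA 1 x 0 y
    have hB0 := nsB 0 0 y 0
    have hB1 := nsB 1 0 y 0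
    simp only [Fin.sum_univ_two] at hA0 hA1 hB0 hB1 hp
    linarith
  have hux (x y) : u x = Q 0 0 x y + Q 0 1 x y - p / 2 := by
    simp only [hu]
    rw [nsB 0 x 0 y, Fin.sum_univ_two]
  have hvy (x y) : v y = Q 0 0 x y + Q 1 0 x y - p / 2 := by
    simp only [hv]
    rw [nsA 0 0 x y, Fin.sum_univ_two]
  have plain (x y : Fin (n + 1)) (h : ¬ ((x : ℕ) = n + 1 - 1 ∧ (y : ℕ) = 0)) :
      |u x - v y| ≤ ∑ a, ∑ b, BCbit (n + 1) a b x y * Q a b x y := by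
    simp only [BCbit, if_neg h, Fin.sum_univ_two]
    norm_num
    rw [hux x y, hvy x y, abs_le]
    constructor <;> linarith [hpos 0 1 x y, hpos 1 0 x y]
  have flipped (x y : Fin (n + 1)) (h : (x : ℕ) = n + 1 - 1 ∧ (y : ℕ) = 0) :
      |u x + v y| ≤ ∑ a, ∑ b, BCbit (n + 1) a b x y * Q a b x y := by
    simp only [BCbit, if_pos h, Fin.sum_univ_two]
    norm_num
    rw [hux x y, hvy x y, abs_le]
    constructor <;> linarith [hpos 0 0 x y, hpos 1 1 x y, total x y]
  have hC (x : Fin (n + 1)) := plain x x (by omega)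
  have hD (i : Fin n) : |u i.castSucc - v i.succ| ≤
      ∑ a, ∑ b, BCbit (n + 1) a b i.castSucc (i.castSucc + 1) *
        Q a b i.castSucc (i.castSucc + 1) := by
    rw [Fin.coeSucc_eq_succ]
    exact plain _ _ (by simp)
  have hlast : |u (Fin.last n) + v 0| ≤
      ∑ a, ∑ b, BCbit (n + 1) a b (Fin.last n) (Fin.last n + 1) *
        Q a b (Fin.last n) (Fin.last n + 1) := by
    rw [Fin.last_add_one]
    exact flipped _ _ (by simp)
  have upper := two_mul_zero_le_sum_add_sum u v _
    (fun x => ∑ a, ∑ b, BCbit (n + 1) a b x (x + 1) * Q a b x (x + 1)) hC hD hlast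
  have lower := two_mul_zero_le_sum_add_sum (fun x => -u x) (fun y => -v y)
    (fun x => ∑ a, ∑ b, BCbit (n + 1) a b x x * Q a b x x)
    (fun x => ∑ a, ∑ b, BCbit (n + 1) a b x (x + 1) * Q a b x (x + 1))
    (fun x => by rw [neg_sub_neg, abs_sub_comm]; exact hC x)
    (fun i => by rw [neg_sub_neg, abs_sub_comm]; exact hD i)
    (by rw [← neg_add, abs_neg]; exact hlast)
  rw [hux 0 y₀] at upper lower
  rw [mul_max_of_nonneg _ _ zero_le_two]
  refine max_le ?_ ?_ <;> rw [Fin.sum_univ_two (fun b => Q _ b 0 y₀)] <;> linarith [total 0 y₀]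

/-- A sum over the second input restricted to `S` has exactly two terms. -/
theorem sum_ite_Sprop {n : ℕ} (hn : 1 ≤ n) (f : Fin (n + 1) → ℝ) (x : Fin (n + 1)) :
    ∑ y, (if Sprop x y then f y else 0) = f x + f (x + 1) := by
  have : NeZero n := ⟨by omega⟩
  have hne : x ≠ x + 1 := by simp
  have hS : Finset.univ.filter (fun y => Sprop x y) = {x, x + 1} := by
    ext y
    rw [Finset.mem_filter_univ, Finset.mem_insert, Finset.mem_singleton, Sprop]
  rw [← Finset.sum_filter, hS, Finset.sum_pair hne]

/-- For any tripartite nonsignaling conditional distribution `P(a,b,e|x,y,z)`, Eve's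
optimal probability of guessing Alice's outcome for input `x = 0` is bounded by the
Braunstein–Caves expectation `⟨ℬ⟩` (with `(X,Y)` uniform on `S`). -/
theorem single_guessing_probability_le_BC
    (M : ℕ) [NeZero M] (hM : 2 ≤ M)
    {E Z : Type} [Fintype E] [Fintype Z]
    (P : Fin 2 → Fin 2 → E → Fin M → Fin M → Z → ℝ)
    (hpos : ∀ a b e x y z, 0 ≤ P a b e x y z)
    (hnorm : ∀ x y z, ∑ a, ∑ b, ∑ e, P a b e x y z = 1)
    (nsA : ∀ (b : Fin 2) (e : E) (x x' y : Fin M) (z : Z),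
      ∑ a, P a b e x y z = ∑ a, P a b e x' y z)
    (nsB : ∀ (a : Fin 2) (e : E) (x y y' : Fin M) (z : Z),
      ∑ b, P a b e x y z = ∑ b, P a b e x y' z)
    (nsE : ∀ a b x y (z z' : Z), ∑ e, P a b e x y z = ∑ e, P a b e x y z') :
    ∀ (y₀ : Fin M) (z₀ : Z) (z : Z),
      ∑ e, max (∑ b, P 0 b e 0 y₀ z) (∑ b, P 1 b e 0 y₀ z)
      ≤ ∑ x : Fin M, ∑ y : Fin M,
          (if Sprop x y then
              (1 / (2 * (M : ℝ))) * ∑ a, ∑ b, BC M a b x y * ∑ e, P a b e x y z₀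
            else 0) := by
  intro y₀ z₀ z
  obtain ⟨n, rfl⟩ : ∃ n, M = n + 1 := ⟨M - 1, by omega⟩
  have hn : 1 ≤ n := by omega
  have hterm (x y : Fin (n + 1)) :
      1 / (2 * ((n + 1 : ℕ) : ℝ)) * ∑ a, ∑ b, BC (n + 1) a b x y * ∑ e, P a b e x y z₀ =
        1 / (4 * ((n + 1 : ℕ) : ℝ)) +
          1 / 2 * ∑ e, ∑ a, ∑ b, BCbit (n + 1) a b x y * P a b e x y z := by
    have hsum : ∑ e, ∑ a, ∑ b, BCbit (n + 1) a b x y * P a b e x y z =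
        ∑ a, ∑ b, BCbit (n + 1) a b x y * ∑ e, P a b e x y z := by
      simp only [Fin.sum_univ_two, Finset.sum_add_distrib, Finset.mul_sum]
    have hBC (a b) : BC (n + 1) a b x y = 1 / 2 + ((n + 1 : ℕ) : ℝ) * BCbit (n + 1) a b x y := rfl
    have hone := hnorm x y z
    rw [hsum]
    simp only [nsE _ _ x y z₀ z, hBC]
    simp only [Fin.sum_univ_two] at hone ⊢
    field_simp
    linear_combination 4 * hone
  have hE (e : E) := two_mul_max_marginal_le hn (fun a b x y => P a b e x y z)
    (fun a b x y => hpos a b e x y z) (fun b x x' y => nsA b e x x' y z)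
    (fun a x y y' => nsB a e x y y' z) y₀
  have hsum := Finset.sum_le_sum fun e (_ : e ∈ Finset.univ) => hE e
  have hone : ∑ e, ∑ a, ∑ b, P a b e 0 0 z = 1 := by
    rw [← hnorm 0 0 z]
    simp only [Fin.sum_univ_two, Finset.sum_add_distrib]
  rw [← Finset.mul_sum, Finset.sum_add_distrib, Finset.sum_add_distrib, hone,
    Finset.sum_comm (f := fun e x => ∑ a, ∑ b, BCbit (n + 1) a b x x * P a b e x x z),
    Finset.sum_comm (f := fun e x => ∑ a, ∑ b, BCbit (n + 1) a b x (x + 1) *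
      P a b e x (x + 1) z)] at hsum
  simp only [hterm]
  have hS (x : Fin (n + 1)) := sum_ite_Sprop hn (fun y => 1 / (4 * ((n + 1 : ℕ) : ℝ)) +
    1 / 2 * ∑ e, ∑ a, ∑ b, BCbit (n + 1) a b x y * P a b e x y z) x
  have hconst : ((n + 1 : ℕ) : ℝ) * (1 / (4 * ((n + 1 : ℕ) : ℝ))) = 1 / 4 := by
    field_simp
  calc _ ≤ _ := ?_
    _ = _ := (Finset.sum_congr rfl fun x _ => hS x).symm
  simp only [Finset.sum_add_distrib, ← Finset.mul_sum, Finset.sum_const, Finset.card_univ,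
    Fintype.card_fin, nsmul_eq_mul, hconst]
  linarith
end

section
/- Let G: {0,1}^N → {0,1}^{N_s} be a two-universal random function. Then for every subset 𝒜 ⊆ {0,1}^N: Σ_{k ∈ {0,1}^{N_s}} Σ_g P_G(g) · | Σ_{a ∈ 𝒜} ( [g(a) = k] − 2^{−N_s} ) | ≤ √( 2^{N_s} · |𝒜| ). -/
open scoped Classical
open Finset

/-- The centred indicators of two points `x`, `y` of a finite type `K` have inner product
`[x = y] - 1 / |K|`. -/
theorem sum_centered_indicator_mul {K : Type*} [Fintype K] [DecidableEq K] {q : ℝ}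
    (hq : (Fintype.card K : ℝ) * q = 1) (x y : K) :
    ∑ k, ((if x = k then (1 : ℝ) else 0) - q) * ((if y = k then (1 : ℝ) else 0) - q)
      = (if x = y then 1 else 0) - q := by
  have expand (k : K) :
      ((if x = k then (1 : ℝ) else 0) - q) * ((if y = k then (1 : ℝ) else 0) - q)
        = (if x = k then (if y = k then (1 : ℝ) else 0) else 0)
          - q * (if x = k then (1 : ℝ) else 0) - q * (if y = k then (1 : ℝ) else 0) + q * q := by
    split_ifs <;> ring
  simp only [expand, sum_add_distrib, sum_sub_distrib, ← mul_sum, sum_ite_eq, mem_univ, if_true,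
    sum_const, card_univ, nsmul_eq_mul, hq]
  simp only [eq_comm (a := y) (b := x)]
  ring

/-- The expected squared deviation of a two-universal hash of `s` from the uniform distribution,
summed over the hash values, is at most `|s|`. -/
theorem sum_expect_sq_deviation_le {G A K : Type*} [Fintype G] [Fintype K] [DecidableEq K]
    {p : G → ℝ} (hp1 : ∑ γ, p γ = 1) {q : ℝ} (hq : (Fintype.card K : ℝ) * q = 1)
    (g : G → A → K)
    (huniv : ∀ a a', a ≠ a' → ∑ γ, p γ * (if g γ a = g γ a' then 1 else 0) ≤ q)
    (s : Finset A) :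
    ∑ k, ∑ γ, p γ * (∑ a ∈ s, ((if g γ a = k then (1 : ℝ) else 0) - q)) ^ 2 ≤ s.card := by
  have hq0 : 0 ≤ q := by
    by_contra! h
    nlinarith [(Nat.cast_nonneg (Fintype.card K) : (0 : ℝ) ≤ _)]
  have key : ∑ k, ∑ γ, p γ * (∑ a ∈ s, ((if g γ a = k then (1 : ℝ) else 0) - q)) ^ 2
      = ∑ a ∈ s, ∑ a' ∈ s, (∑ γ, p γ * (if g γ a = g γ a' then 1 else 0) - q) := by
    have inner (a a' : A) : ∑ γ, p γ * (if g γ a = g γ a' then 1 else 0) - q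
        = ∑ γ, p γ * ((if g γ a = g γ a' then 1 else 0) - q) := by
      simp only [mul_sub, sum_sub_distrib, ← sum_mul, hp1, one_mul]
    simp only [inner]
    rw [sum_comm]
    simp_rw [sum_comm (s := s) (t := (univ : Finset G))]
    refine sum_congr rfl fun γ _ => ?_
    simp only [← mul_sum, sq, sum_mul]
    congr 1
    rw [sum_comm]
    refine sum_congr rfl fun a _ => ?_
    simp_rw [mul_sum]
    rw [sum_comm]
    exact sum_congr rfl fun a' _ => sum_centered_indicator_mul hq _ _
  rw [key]
  calc _ ≤ ∑ a ∈ s, ∑ a' ∈ s, (if a = a' then (1 : ℝ) else 0) := by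
        refine sum_le_sum fun a _ => sum_le_sum fun a' _ => ?_
        split_ifs with h
        · subst h
          simpa [hp1] using hq0
        · exact sub_nonpos.2 (huniv a a' h)
    _ = s.card := by simp

/-- Lemma 8 of the paper: for a two-universal random function
`G : {0,1}^N → {0,1}^{N_s}` and any subset `𝒜 ⊆ {0,1}^N`,
`Σ_k Σ_g P_G(g)·|Σ_{a ∈ 𝒜} ([g(a)=k] − 2^{-N_s})| ≤ √(2^{N_s}·|𝒜|)`. -/
theorem two_universal_hashing_bound
    (N Ns : ℕ) {G : Type} [Fintype G]
    (PG : G → ℝ) (hPG0 : ∀ γ, 0 ≤ PG γ) (hPG1 : ∑ γ, PG γ = 1)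
    (g : G → (Fin N → Fin 2) → (Fin Ns → Fin 2))
    (huniv : ∀ a a' : Fin N → Fin 2, a ≠ a' →
      ∑ γ, PG γ * (if g γ a = g γ a' then 1 else 0) ≤ ((2 : ℝ) ^ Ns)⁻¹) :
    ∀ 𝒜 : Finset (Fin N → Fin 2),
      ∑ k : Fin Ns → Fin 2, ∑ γ : G, PG γ *
          |∑ a ∈ 𝒜, ((if g γ a = k then (1 : ℝ) else 0) - ((2 : ℝ) ^ Ns)⁻¹)|
        ≤ Real.sqrt ((2 : ℝ) ^ Ns * 𝒜.card) := by
  intro 𝒜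
  have hq : (Fintype.card (Fin Ns → Fin 2) : ℝ) * ((2 : ℝ) ^ Ns)⁻¹ = 1 := by simp
  have hvar := sum_expect_sq_deviation_le hPG1 hq g huniv 𝒜
  refine Real.le_sqrt_of_sq_le ?_
  have cauchy := sum_sq_le_sum_mul_sum_of_sq_le_mul
    (univ : Finset ((Fin Ns → Fin 2) × G))
    (r := fun x => PG x.2 *
      |∑ a ∈ 𝒜, ((if g x.2 a = x.1 then (1 : ℝ) else 0) - ((2 : ℝ) ^ Ns)⁻¹)|)
    (f := fun x => PG x.2)
    (g := fun x => PG x.2 *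
      (∑ a ∈ 𝒜, ((if g x.2 a = x.1 then (1 : ℝ) else 0) - ((2 : ℝ) ^ Ns)⁻¹)) ^ 2)
    (fun x _ => hPG0 x.2) (fun x _ => mul_nonneg (hPG0 x.2) (sq_nonneg _))
    (fun x _ => le_of_eq (by rw [mul_pow, sq_abs]; ring))
  simp only [Fintype.sum_prod_type] at cauchy
  have hmass : ∑ _k : Fin Ns → Fin 2, ∑ γ, PG γ = (2 : ℝ) ^ Ns := by simp [hPG1]
  rw [hmass] at cauchy
  exact cauchy.trans (mul_le_mul_of_nonneg_left hvar (by positivity))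
end

section
/- Let G: {0,1}^N → {0,1}^{N_s} be a two-universal random function. Then for every subset 𝒜 ⊆ {0,1}^N the following componentwise vector inequality holds: for every index tuple (𝐚',𝐛,𝐱,𝐲) ∈ ({0,1}×{0,1}×{0,…,M−1}×{0,…,M−1})^N, Σ_{k ∈ {0,1}^{N_s}} Σ_g P_G(g) · | Σ_{𝐚 ∈ 𝒜} ( [g(𝐚) = k] − 2^{−N_s} ) · Π_{n=1}^N β_{a_n}(a'_n,b_n,x_n,y_n) | ≤ √( 2^{1+N_s} · |𝒜| ) · Π_{n=1}^N β(a'_n,b_n,x_n,y_n). -/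
open scoped Classical
open Finset

set_option linter.unusedVariables false

/-- Both signed vectors are dominated by `β`. -/
lemma abs_βa_le_βv (M : ℕ) [NeZero M] (c a b : Fin 2) (x y : Fin M) :
    |βa M c a b x y| ≤ βv M a b x y := by
  have hμ : 0 ≤ μv M a b x y := by unfold μv; split_ifs <;> positivity
  calc |βa M c a b x y| ≤ |μv M a b x y| + |(-1 : ℝ) ^ (c : ℕ) * νv M a b x y| := abs_add_le _ _
    _ = βv M a b x y := by simp [βv, abs_mul, abs_of_nonneg hμ]

/-- The squared deviation of the fibre sums of `c` under `f` from uniform, as a quadratic form. -/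
lemma sum_sq_fiber_deviation {α κ : Type*} [Fintype κ] [Nonempty κ] [DecidableEq κ]
    (f : α → κ) (s : Finset α) (c : α → ℝ) :
    ∑ k, (∑ a ∈ s, ((if f a = k then (1 : ℝ) else 0) - (Fintype.card κ : ℝ)⁻¹) * c a) ^ 2 =
      ∑ a ∈ s, ∑ a' ∈ s,
        ((if f a = f a' then (1 : ℝ) else 0) - (Fintype.card κ : ℝ)⁻¹) * (c a * c a') := by
  have hcard : (Fintype.card κ : ℝ) ≠ 0 := by exact_mod_cast Fintype.card_ne_zero
  simp_rw [sq, Finset.sum_mul_sum]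
  rw [Finset.sum_comm]
  refine Finset.sum_congr rfl fun a _ => ?_
  rw [Finset.sum_comm]
  refine Finset.sum_congr rfl fun a' _ => ?_
  have key : ∑ k, ((if f a = k then (1 : ℝ) else 0) - (Fintype.card κ : ℝ)⁻¹) *
      ((if f a' = k then (1 : ℝ) else 0) - (Fintype.card κ : ℝ)⁻¹) =
      (if f a = f a' then (1 : ℝ) else 0) - (Fintype.card κ : ℝ)⁻¹ := by
    simp only [sub_mul, mul_sub, Finset.sum_sub_distrib, ← Finset.mul_sum,
      ite_mul, one_mul, zero_mul, Finset.sum_ite_eq, Finset.mem_univ, if_true,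
      Finset.sum_const, Finset.card_univ, nsmul_eq_mul]
    rw [mul_inv_cancel₀ hcard]
    simp only [eq_comm (a := f a')]
    ring
  rw [← key, Finset.sum_mul]
  exact Finset.sum_congr rfl fun k _ => by ring

/-- The second-moment bound for two-universal hashing: the off-diagonal collision excesses are
nonpositive, while all excesses over `s` sum to a nonnegative number, so that their absolute
values sum to at most `2 * #s`. -/
lemma sum_sq_fiber_deviation_le {α κ G : Type*} [Fintype κ] [Nonempty κ] [DecidableEq κ]
    [Fintype G] (P : G → ℝ) (hP0 : ∀ γ, 0 ≤ P γ) (hP1 : ∑ γ, P γ = 1) (g : G → α → κ)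
    (huniv : ∀ a a', a ≠ a' →
      ∑ γ, P γ * (if g γ a = g γ a' then 1 else 0) ≤ (Fintype.card κ : ℝ)⁻¹)
    (s : Finset α) (c : α → ℝ) (B : ℝ) (hc : ∀ a, |c a| ≤ B) :
    ∑ γ, P γ * ∑ k,
        (∑ a ∈ s, ((if g γ a = k then (1 : ℝ) else 0) - (Fintype.card κ : ℝ)⁻¹) * c a) ^ 2 ≤
      2 * s.card * B ^ 2 := by
  classical
  set p : ℝ := (Fintype.card κ : ℝ)⁻¹ with hp
  have hp0 : 0 ≤ p := by positivity
  set Q : α → α → ℝ := fun a a' => ∑ γ, P γ * ((if g γ a = g γ a' then (1 : ℝ) else 0) - p)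
    with hQ
  have expand : ∀ d : α → ℝ, ∑ γ, P γ * ∑ k,
      (∑ a ∈ s, ((if g γ a = k then (1 : ℝ) else 0) - p) * d a) ^ 2 =
      ∑ a ∈ s, ∑ a' ∈ s, Q a a' * (d a * d a') := by
    intro d
    simp_rw [hp, sum_sq_fiber_deviation, Finset.mul_sum]
    rw [Finset.sum_comm]
    refine Finset.sum_congr rfl fun a _ => ?_
    rw [Finset.sum_comm]
    refine Finset.sum_congr rfl fun a' _ => ?_
    rw [hQ, Finset.sum_mul]
    exact Finset.sum_congr rfl fun γ _ => by ring
  have hQsub : ∀ a a', Q a a' = ∑ γ, P γ * (if g γ a = g γ a' then (1 : ℝ) else 0) - p := by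
    intro a a'
    simp only [hQ, mul_sub, Finset.sum_sub_distrib, ← Finset.sum_mul, hP1, one_mul]
  have hQdiag : ∀ a, Q a a = 1 - p := fun a => by simp [hQsub, hP1]
  have hQoff : ∀ a a', a ≠ a' → Q a a' ≤ 0 := fun a a' h => by
    rw [hQsub]; exact sub_nonpos.2 (huniv a a' h)
  have hQsum : 0 ≤ ∑ a ∈ s, ∑ a' ∈ s, Q a a' := by
    have h := expand fun _ => 1
    simp only [mul_one] at h
    rw [← h]
    exact Finset.sum_nonneg fun γ _ => mul_nonneg (hP0 γ) (Finset.sum_nonneg fun k _ => sq_nonneg _)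
  have hQabs : ∀ a a', |Q a a'| ≤ (if a = a' then 2 else 0) - Q a a' := by
    intro a a'
    split_ifs with h
    · subst h
      have hp1 : p ≤ 1 := Nat.cast_inv_le_one _
      rw [hQdiag, abs_of_nonneg (by linarith)]
      linarith
    · rw [abs_of_nonpos (hQoff a a' h)]; simp
  calc _ = ∑ a ∈ s, ∑ a' ∈ s, Q a a' * (c a * c a') := expand c
    _ ≤ ∑ a ∈ s, ∑ a' ∈ s, ((if a = a' then 2 else 0) - Q a a') * B ^ 2 := by
      refine Finset.sum_le_sum fun a _ => Finset.sum_le_sum fun a' _ => ?_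
      have hB : |c a * c a'| ≤ B ^ 2 := by
        rw [abs_mul, sq]
        exact mul_le_mul (hc a) (hc a') (abs_nonneg _) ((abs_nonneg _).trans (hc a))
      calc Q a a' * (c a * c a') ≤ |Q a a'| * |c a * c a'| := (le_abs_self _).trans (abs_mul _ _).le
        _ ≤ _ := mul_le_mul (hQabs a a') hB (abs_nonneg _) ((abs_nonneg _).trans (hQabs a a'))
    _ = (2 * s.card - ∑ a ∈ s, ∑ a' ∈ s, Q a a') * B ^ 2 := by
      simp only [← Finset.sum_mul, Finset.sum_sub_distrib, Finset.sum_ite_eq,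
        Finset.sum_ite_mem, Finset.inter_self, Finset.sum_const, nsmul_eq_mul]
      ring
    _ ≤ 2 * s.card * B ^ 2 := by
      have := mul_nonneg hQsum (sq_nonneg B)
      linarith

/-- Leftover hashing for bounded real weights: the expected `ℓ¹` deviation of the fibre sums from
uniform under a two-universal random function. -/
lemma sum_abs_fiber_deviation_le {α κ G : Type*} [Fintype κ] [Nonempty κ] [DecidableEq κ]
    [Fintype G] (P : G → ℝ) (hP0 : ∀ γ, 0 ≤ P γ) (hP1 : ∑ γ, P γ = 1) (g : G → α → κ)
    (huniv : ∀ a a', a ≠ a' →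
      ∑ γ, P γ * (if g γ a = g γ a' then 1 else 0) ≤ (Fintype.card κ : ℝ)⁻¹)
    (s : Finset α) (c : α → ℝ) (B : ℝ) (hB : 0 ≤ B) (hc : ∀ a, |c a| ≤ B) :
    ∑ k, ∑ γ, P γ *
        |∑ a ∈ s, ((if g γ a = k then (1 : ℝ) else 0) - (Fintype.card κ : ℝ)⁻¹) * c a| ≤
      √(2 * Fintype.card κ * s.card) * B := by
  set D : G → κ → ℝ := fun γ k =>
    ∑ a ∈ s, ((if g γ a = k then (1 : ℝ) else 0) - (Fintype.card κ : ℝ)⁻¹) * c a with hD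
  have hsecond : ∑ γ, P γ * ∑ k, D γ k ^ 2 ≤ 2 * s.card * B ^ 2 :=
    sum_sq_fiber_deviation_le P hP0 hP1 g huniv s c B hc
  have hjensen : (∑ γ, P γ * ∑ k, |D γ k|) ^ 2 ≤ ∑ γ, P γ * (∑ k, |D γ k|) ^ 2 :=
    by
    simpa only [smul_eq_mul] using (even_two.convexOn_pow (𝕜 := ℝ)).map_sum_le
      (fun γ _ => hP0 γ) hP1 (fun γ _ => Set.mem_univ (∑ k, |D γ k|))
  have hcauchy : ∀ γ, (∑ k, |D γ k|) ^ 2 ≤ Fintype.card κ * ∑ k, D γ k ^ 2 := fun γ => by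
    simpa using sq_sum_le_card_mul_sum_sq (s := Finset.univ) (f := fun k => |D γ k|)
  have hswap : ∑ k, ∑ γ, P γ * |D γ k| = ∑ γ, P γ * ∑ k, |D γ k| := by
    rw [Finset.sum_comm]
    simp only [Finset.mul_sum]
  have hsq : (∑ γ, P γ * ∑ k, |D γ k|) ^ 2 ≤ 2 * Fintype.card κ * s.card * B ^ 2 :=
    calc _ ≤ ∑ γ, P γ * (∑ k, |D γ k|) ^ 2 := hjensen
      _ ≤ ∑ γ, P γ * (Fintype.card κ * ∑ k, D γ k ^ 2) :=
        Finset.sum_le_sum fun γ _ => mul_le_mul_of_nonneg_left (hcauchy γ) (hP0 γ)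
      _ = Fintype.card κ * ∑ γ, P γ * ∑ k, D γ k ^ 2 := by
        rw [Finset.mul_sum]
        exact Finset.sum_congr rfl fun γ _ => by ring
      _ ≤ Fintype.card κ * (2 * s.card * B ^ 2) := by gcongr
      _ = _ := by ring
  rw [hswap, ← Real.sqrt_sq hB, ← Real.sqrt_mul (by positivity)]
  exact Real.le_sqrt_of_sq_le hsq

/-- The componentwise vector inequality (inequality (41) of the paper) for a two-universal
random function `G : {0,1}^N → {0,1}^{N_s}` and any subset `𝒜 ⊆ {0,1}^N`. -/
theorem two_universal_hashing_beta_bound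
    (M : ℕ) [NeZero M] (hM : 2 ≤ M) (N Ns : ℕ) {G : Type} [Fintype G]
    (PG : G → ℝ) (hPG0 : ∀ γ, 0 ≤ PG γ) (hPG1 : ∑ γ, PG γ = 1)
    (g : G → (Fin N → Fin 2) → (Fin Ns → Fin 2))
    (huniv : ∀ a a' : Fin N → Fin 2, a ≠ a' →
      ∑ γ, PG γ * (if g γ a = g γ a' then 1 else 0) ≤ ((2 : ℝ) ^ Ns)⁻¹) :
    ∀ (𝒜 : Finset (Fin N → Fin 2)) (a' b : Fin N → Fin 2) (x y : Fin N → Fin M),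
      ∑ k : Fin Ns → Fin 2, ∑ γ : G, PG γ *
          |∑ a ∈ 𝒜, ((if g γ a = k then (1 : ℝ) else 0) - ((2 : ℝ) ^ Ns)⁻¹) *
            ∏ n, βa M (a n) (a' n) (b n) (x n) (y n)|
        ≤ Real.sqrt ((2 : ℝ) ^ (1 + Ns) * 𝒜.card) * ∏ n, βv M (a' n) (b n) (x n) (y n) := by
  intro 𝒜 a' b x y
  have hcard : (Fintype.card (Fin Ns → Fin 2) : ℝ) = 2 ^ Ns := by simp
  have hβ : ∀ n, 0 ≤ βv M (a' n) (b n) (x n) (y n) := fun n =>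
    (abs_nonneg _).trans (abs_βa_le_βv M 0 _ _ _ _)
  have h := sum_abs_fiber_deviation_le PG hPG0 hPG1 g (by rwa [hcard]) 𝒜
    (fun a => ∏ n, βa M (a n) (a' n) (b n) (x n) (y n)) (∏ n, βv M (a' n) (b n) (x n) (y n))
    (Finset.prod_nonneg fun n _ => hβ n) fun a => by
      rw [Finset.abs_prod]
      exact Finset.prod_le_prod (fun n _ => abs_nonneg _) fun n _ => abs_βa_le_βv M _ _ _ _ _
  rw [hcard] at h
  rwa [pow_add, pow_one]
end

section
/- Let P(𝐚,𝐛,e|𝐱,𝐲,z) be any (2N+1)-partite nonsignaling conditional distribution. Then for every z, every subset 𝒜 ⊆ {0,1}^N, and every family of real coefficients (η_𝐚)_{𝐚 ∈ 𝒜}: Σ_e | Σ_{𝐚 ∈ 𝒜} η_𝐚 · P_{𝐀,E|𝐗,Z}(𝐚,e|𝟎,z) | ≤ | Σ_{𝐚 ∈ 𝒜} η_𝐚 · (β_{a_1} ⊗ ⋯ ⊗ β_{a_N}) | · P_AB, where P_{𝐀,E|𝐗,Z}(𝐚,e|𝟎,z) = Σ_𝐛 P(𝐚,𝐛,e|𝟎,𝐲,z)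 (independent of 𝐲 by nonsignaling), P_AB(𝐚,𝐛|𝐱,𝐲) = Σ_e P(𝐚,𝐛,e|𝐱,𝐲,z) (independent of z by nonsignaling), |·| of a vector is componentwise, and the final dot product sums over all 4N indices. -/
open scoped Classical
open Finset

set_option linter.unusedVariables false

lemma βa_zero_zero {m : ℕ} (hm : 1 ≤ m) (α a b : Fin 2) :
    βa (m + 1) α a b 0 0 = 1 / (4 * ((m : ℝ) + 1)) + (-1 : ℝ) ^ (α : ℕ) / 4 * (-1 : ℝ) ^ (a : ℕ)
      + -((-1 : ℝ) ^ (α : ℕ) / 4) * (-1 : ℝ) ^ (b : ℕ) := by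
  simp [βa, μv, νv, Sprop]
  ring

lemma βa_succ_succ {m : ℕ} (α a b : Fin 2) (i : Fin m) :
    βa (m + 1) α a b i.succ i.succ = 1 / (4 * ((m : ℝ) + 1))
      + -((-1 : ℝ) ^ (α : ℕ) / 4) * (-1 : ℝ) ^ (a : ℕ)
      + (-1 : ℝ) ^ (α : ℕ) / 4 * (-1 : ℝ) ^ (b : ℕ) := by
  simp [βa, μv, νv, Sprop]
  ring

lemma βa_castSucc_succ {m : ℕ} (α a b : Fin 2) (i : Fin m) :
    βa (m + 1) α a b i.castSucc i.succ = 1 / (4 * ((m : ℝ) + 1))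
      + (-1 : ℝ) ^ (α : ℕ) / 4 * (-1 : ℝ) ^ (a : ℕ)
      + -((-1 : ℝ) ^ (α : ℕ) / 4) * (-1 : ℝ) ^ (b : ℕ) := by
  simp [βa, μv, νv, Sprop, Fin.coeSucc_eq_succ]
  ring

lemma βa_last_zero {m : ℕ} (hm : 1 ≤ m) (α a b : Fin 2) :
    βa (m + 1) α a b (Fin.last m) 0 = 1 / (4 * ((m : ℝ) + 1))
      + (-1 : ℝ) ^ (α : ℕ) / 4 * (-1 : ℝ) ^ (a : ℕ)
      + (-1 : ℝ) ^ (α : ℕ) / 4 * (-1 : ℝ) ^ (b : ℕ) := by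
  have h1 : m ≠ 0 := by lia
  have h2 : (0 : Fin (m + 1)) ≠ Fin.last m := by
    simp [Fin.ext_iff]; lia
  simp [βa, μv, νv, Sprop, h1, h2]
  ring

lemma βa_eq_zero {m : ℕ} (α a b : Fin 2) {x y : Fin (m + 1)} (h1 : y ≠ x) (h2 : y ≠ x + 1) :
    βa (m + 1) α a b x y = 0 := by
  have h3 : (y : ℕ) ≠ (x : ℕ) + 1 := by
    intro h
    apply h2
    ext
    rw [Fin.val_add_one_of_lt' (by have := y.isLt; lia), h]
  have h4 : ¬ ((x : ℕ) = 0 ∧ (y : ℕ) = 0) := by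
    rintro ⟨hx, hy⟩
    exact h1 (Fin.ext (by lia))
  have h5 : ¬ ((x : ℕ) = m ∧ (y : ℕ) = 0) := by
    rintro ⟨hx, hy⟩
    apply h2
    have hx' : x = Fin.last m := Fin.ext hx
    have hy' : y = 0 := Fin.ext hy
    simp [hx', hy']
  have h6 : ¬ (y = x ∧ 1 ≤ (x : ℕ)) := fun h => h1 h.1
  have h7 : ¬ Sprop x y := by
    rintro (h | h)
    exacts [h1 h, h2 h]
  simp only [βa, μv, νv, Nat.add_sub_cancel, if_neg h5, if_neg h6, if_neg h7, h3, h4,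
    or_self, if_false]
  simp

/-- Contracting a function supported on the cyclic chain `y = x` or `y = x + 1`. -/
lemma sum_sum_cyclic_chain {m : ℕ} (hm : 1 ≤ m) (f : Fin (m + 1) → Fin (m + 1) → ℝ)
    (hf : ∀ x y, y ≠ x → y ≠ x + 1 → f x y = 0) :
    ∑ x, ∑ y, f x y = f 0 0 + f (Fin.last m) 0
      + ∑ i : Fin m, (f i.succ i.succ + f i.castSucc i.succ) := by
  have hrow : ∀ x, ∑ y, f x y = f x x + f x (x + 1) := by
    intro x
    have hne : x ≠ x + 1 := by
      have : Nontrivial (Fin (m + 1)) := Fin.nontrivial_iff_two_le.2 (by lia)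
      simpa using (show m ≠ 0 by lia)
    exact Fintype.sum_eq_add x (x + 1) hne fun y hy => hf x y hy.1 hy.2
  simp only [hrow, Finset.sum_add_distrib]
  rw [Fin.sum_univ_succ (fun x => f x x), Fin.sum_univ_castSucc (fun x => f x (x + 1))]
  simp only [Fin.coeSucc_eq_succ, Fin.last_add_one]
  ring

/-- A bipartite nonsignaling vector paired with `β_α` gives the marginal at `α` for input `0`. -/
lemma sum_βa_mul_eq_marginal (M : ℕ) [NeZero M] (hM : 2 ≤ M)
    (Q : Fin 2 → Fin 2 → Fin M → Fin M → ℝ)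
    (hA : ∀ b x x' y, ∑ a, Q a b x y = ∑ a, Q a b x' y)
    (hB : ∀ a x y y', ∑ b, Q a b x y = ∑ b, Q a b x y') (α : Fin 2) :
    ∑ a, ∑ b, ∑ x, ∑ y, βa M α a b x y * Q a b x y = ∑ b, Q α b 0 0 := by
  obtain ⟨m, rfl⟩ : ∃ m, M = m + 1 := ⟨M - 1, by lia⟩
  have hm : 1 ≤ m := by lia
  simp only [Fin.sum_univ_two] at hA hB
  obtain ⟨T, hT⟩ : ∃ T : ℝ, T = ∑ a, ∑ b, Q a b 0 0 := ⟨_, rfl⟩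
  set A : Fin (m + 1) → ℝ := fun x => Q 0 0 x 0 + Q 0 1 x 0 - (Q 1 0 x 0 + Q 1 1 x 0) with hAdef
  set B : Fin (m + 1) → ℝ := fun y => Q 0 0 0 y + Q 1 0 0 y - (Q 0 1 0 y + Q 1 1 0 y) with hBdef
  have key : ∀ (x y : Fin (m + 1)) (s u v : ℝ),
      ∑ a : Fin 2, ∑ b : Fin 2, (s + u * (-1 : ℝ) ^ (a : ℕ) + v * (-1 : ℝ) ^ (b : ℕ)) * Q a b x y
        = s * T + u * A x + v * B y := by
    intro x y s u v
    simp only [hT, hAdef, hBdef, Fin.sum_univ_two, Fin.val_zero, Fin.val_one, pow_zero, pow_one]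
    linear_combination (s + v) * hA 0 x 0 y + (s - v) * hA 1 x 0 y + u * (hB 0 x y 0 - hB 1 x y 0)
      + s * (hB 0 0 y 0 + hB 1 0 y 0)
  have hswap : ∑ a, ∑ b, ∑ x, ∑ y, βa (m + 1) α a b x y * Q a b x y
      = ∑ x, ∑ y, ∑ a, ∑ b, βa (m + 1) α a b x y * Q a b x y := by
    simp only [Fin.sum_univ_two, Finset.sum_add_distrib]
  rw [hswap, sum_sum_cyclic_chain hm _ fun x y h1 h2 => by simp [βa_eq_zero α _ _ h1 h2]]
  simp only [βa_zero_zero hm, βa_succ_succ, βa_castSucc_succ, βa_last_zero hm, key]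
  have htel : ∑ i : Fin m, A i.castSucc - ∑ i : Fin m, A i.succ = A 0 - A (Fin.last m) := by
    have h1 := Fin.sum_univ_succ A
    have h2 := Fin.sum_univ_castSucc A
    linarith
  have hsum : ∀ s c : ℝ, ∑ i : Fin m, (s * T + -c * A i.succ + c * B i.succ
        + (s * T + c * A i.castSucc + -c * B i.succ))
      = 2 * m * s * T + c * (A 0 - A (Fin.last m)) := by
    intro s c
    rw [← htel, ← Finset.sum_sub_distrib, Finset.mul_sum]
    have : 2 * m * s * T = ∑ i : Fin m, 2 * (s * T) := by
      rw [Finset.sum_const, Finset.card_univ, Fintype.card_fin, nsmul_eq_mul]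
      ring
    rw [this, ← Finset.sum_add_distrib]
    exact Finset.sum_congr rfl fun i _ => by ring
  rw [hsum]
  have hfin : (-1 : ℝ) ^ (α : ℕ) / 2 * A 0 + T / 2 = ∑ b, Q α b 0 0 := by
    simp only [hT, hAdef]
    fin_cases α <;> simp [Fin.sum_univ_two] <;> ring
  rw [← hfin]
  field_simp
  ring

/-- Splitting off the first coordinate in a sum over tuples. -/
lemma sum_fin_cons {X : Type*} [Fintype X] {n : ℕ} (g : (Fin (n + 1) → X) → ℝ) :
    ∑ t, g t = ∑ h : X, ∑ t : Fin n → X, g (Fin.cons h t : Fin (n + 1) → X) := by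
  rw [← (Fin.consEquiv fun _ => X).sum_comp, Fintype.sum_prod_type]
  rfl

/-- Moving four head summations inside the corresponding tail summations. -/
lemma sum_four_heads_comm {X₁ X₂ X₃ X₄ Y₁ Y₂ Y₃ Y₄ : Type*} [Fintype X₁] [Fintype X₂] [Fintype X₃]
    [Fintype X₄] [Fintype Y₁] [Fintype Y₂] [Fintype Y₃] [Fintype Y₄]
    (g : X₁ → Y₁ → X₂ → Y₂ → X₃ → Y₃ → X₄ → Y₄ → ℝ) :
    ∑ a, ∑ s, ∑ b, ∑ t, ∑ c, ∑ u, ∑ d, ∑ v, g a s b t c u d v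
      = ∑ s, ∑ t, ∑ u, ∑ v, ∑ a, ∑ b, ∑ c, ∑ d, g a s b t c u d v := by
  rw [Finset.sum_comm]
  refine Finset.sum_congr rfl fun s _ => ?_
  calc _ = ∑ a, ∑ t, ∑ b, ∑ u, ∑ c, ∑ v, ∑ d, g a s b t c u d v := by
        refine Finset.sum_congr rfl fun a _ => ?_
        rw [Finset.sum_comm]
        iterate 2 refine Finset.sum_congr rfl fun _ _ => ?_
        rw [Finset.sum_comm]
        iterate 2 refine Finset.sum_congr rfl fun _ _ => ?_
        rw [Finset.sum_comm]
    _ = ∑ t, ∑ a, ∑ u, ∑ b, ∑ v, ∑ c, ∑ d, g a s b t c u d v := by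
        rw [Finset.sum_comm]
        iterate 2 refine Finset.sum_congr rfl fun _ _ => ?_
        rw [Finset.sum_comm]
        iterate 2 refine Finset.sum_congr rfl fun _ _ => ?_
        rw [Finset.sum_comm]
    _ = ∑ t, ∑ u, ∑ a, ∑ v, ∑ b, ∑ c, ∑ d, g a s b t c u d v := by
        refine Finset.sum_congr rfl fun _ _ => ?_
        rw [Finset.sum_comm]
        iterate 2 refine Finset.sum_congr rfl fun _ _ => ?_
        rw [Finset.sum_comm]
    _ = _ := by
        iterate 2 refine Finset.sum_congr rfl fun _ _ => ?_
        rw [Finset.sum_comm]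

/-- Contracting every pair of sites of a nonsignaling vector with `β` gives the marginal of the
first outputs at input `0`. -/
lemma sum_prod_βa_mul_eq_marginal (M : ℕ) [NeZero M] (hM : 2 ≤ M) (N : ℕ)
    (F : (Fin N → Fin 2) → (Fin N → Fin 2) → (Fin N → Fin M) → (Fin N → Fin M) → ℝ)
    (hA : ∀ (n : Fin N) a b x x' y, (∀ k, k ≠ n → x k = x' k) →
      ∑ v, F (Function.update a n v) b x y = ∑ v, F (Function.update a n v) b x' y)
    (hB : ∀ (n : Fin N) a b x y y', (∀ k, k ≠ n → y k = y' k) →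
      ∑ v, F a (Function.update b n v) x y = ∑ v, F a (Function.update b n v) x y')
    (α : Fin N → Fin 2) :
    ∑ a, ∑ b, ∑ x, ∑ y, (∏ n, βa M (α n) (a n) (b n) (x n) (y n)) * F a b x y
      = ∑ b, F α b (fun _ => 0) (fun _ => 0) := by
  induction N with
  | zero =>
    simp only [Fintype.sum_unique, Finset.univ_eq_empty, Finset.prod_empty, one_mul]
    congr 1 <;> exact Subsingleton.elim _ _
  | succ N ih =>
    have hcons0 : (Fin.cons 0 (fun _ => 0) : Fin (N + 1) → Fin M) = fun _ => 0 := by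
      funext i
      refine Fin.cases ?_ (fun j => ?_) i <;> simp
    have hsite : ∀ (a b : Fin N → Fin 2) (x y : Fin N → Fin M),
        ∑ a₀, ∑ b₀, ∑ x₀, ∑ y₀, βa M (α 0) a₀ b₀ x₀ y₀ *
          F (Fin.cons a₀ a) (Fin.cons b₀ b) (Fin.cons x₀ x) (Fin.cons y₀ y)
        = ∑ b₀, F (Fin.cons (α 0) a) (Fin.cons b₀ b) (Fin.cons 0 x) (Fin.cons 0 y) := by
      intro a b x y
      refine sum_βa_mul_eq_marginal M hM (fun a₀ b₀ x₀ y₀ =>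
        F (Fin.cons a₀ a) (Fin.cons b₀ b) (Fin.cons x₀ x) (Fin.cons y₀ y)) ?_ ?_ (α 0)
      · intro b₀ x₀ x₀' y₀
        have := hA 0 (Fin.cons 0 a) (Fin.cons b₀ b) (Fin.cons x₀ x) (Fin.cons x₀' x)
          (Fin.cons y₀ y) (fun k hk => by
            obtain ⟨j, rfl⟩ := Fin.exists_succ_eq.2 hk
            simp)
        simpa only [Fin.update_cons_zero] using this
      · intro a₀ x₀ y₀ y₀'
        have := hB 0 (Fin.cons a₀ a) (Fin.cons 0 b) (Fin.cons x₀ x) (Fin.cons y₀ y)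
          (Fin.cons y₀' y) (fun k hk => by
            obtain ⟨j, rfl⟩ := Fin.exists_succ_eq.2 hk
            simp)
        simpa only [Fin.update_cons_zero] using this
    have htail := ih (fun a b x y => ∑ b₀,
        F (Fin.cons (α 0) a) (Fin.cons b₀ b) (Fin.cons 0 x) (Fin.cons 0 y))
      (fun n a b x x' y h => by
        rw [Finset.sum_comm]
        conv_rhs => rw [Finset.sum_comm]
        refine Finset.sum_congr rfl fun b₀ _ => ?_
        simp only [Fin.cons_update]
        refine hA n.succ _ _ _ _ _ fun k hk => ?_
        induction k using Fin.cases with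
        | zero => simp
        | succ j => simpa using h j (fun hj => hk (by rw [hj])))
      (fun n a b x y y' h => by
        rw [Finset.sum_comm]
        conv_rhs => rw [Finset.sum_comm]
        refine Finset.sum_congr rfl fun b₀ _ => ?_
        simp only [Fin.cons_update]
        refine hB n.succ _ _ _ _ _ fun k hk => ?_
        induction k using Fin.cases with
        | zero => simp
        | succ j => simpa using h j (fun hj => hk (by rw [hj])))
      (fun n => α n.succ)
    have hα : (Fin.cons (α 0) (fun n => α n.succ) : Fin (N + 1) → Fin 2) = α :=
      Fin.cons_self_tail α
    simp only [hα, hcons0] at htail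
    rw [sum_fin_cons (fun b => F α b (fun _ => 0) (fun _ => 0))]
    conv_rhs => rw [Finset.sum_comm, ← htail]
    simp only [← hsite]
    simp only [sum_fin_cons, Fin.prod_univ_succ, Fin.cons_zero, Fin.cons_succ, Finset.mul_sum]
    rw [sum_four_heads_comm]
    iterate 8 refine Finset.sum_congr rfl fun _ _ => ?_
    ring

/-- Inequality (45) of the paper: for any `(2N+1)`-partite nonsignaling conditional
distribution, any `z`, any subset `𝒜 ⊆ {0,1}^N` and any real coefficients `η`,
`Σ_e |Σ_{𝐚 ∈ 𝒜} η_𝐚 P(𝐚,e|𝟎,z)| ≤ |Σ_{𝐚 ∈ 𝒜} η_𝐚 (β_{a₁} ⊗ ⋯ ⊗ β_{a_N})| · P_AB`. -/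
theorem eve_sum_le_beta_dot
    (M N : ℕ) [NeZero M] (hM : 2 ≤ M) (hN : 1 ≤ N)
    {E Z : Type} [Fintype E] [Fintype Z]
    (P : (Fin N → Fin 2) → (Fin N → Fin 2) → E →
         (Fin N → Fin M) → (Fin N → Fin M) → Z → ℝ)
    (hpos : ∀ a b e x y z, 0 ≤ P a b e x y z)
    (hnorm : ∀ x y z, ∑ a, ∑ b, ∑ e, P a b e x y z = 1)
    (nsA : ∀ (n : Fin N) (a b : Fin N → Fin 2) (e : E) (x x' y : Fin N → Fin M) (z : Z),
      (∀ m, m ≠ n → x m = x' m) →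
      ∑ v : Fin 2, P (Function.update a n v) b e x y z
        = ∑ v : Fin 2, P (Function.update a n v) b e x' y z)
    (nsB : ∀ (n : Fin N) (a b : Fin N → Fin 2) (e : E) (x y y' : Fin N → Fin M) (z : Z),
      (∀ m, m ≠ n → y m = y' m) →
      ∑ v : Fin 2, P a (Function.update b n v) e x y z
        = ∑ v : Fin 2, P a (Function.update b n v) e x y' z)
    (nsE : ∀ a b x y (z z' : Z), ∑ e, P a b e x y z = ∑ e, P a b e x y z') :
    ∀ (z z₀ : Z) (𝒜 : Finset (Fin N → Fin 2)) (η : (Fin N → Fin 2) → ℝ),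
      ∑ e, |∑ a ∈ 𝒜, η a * ∑ b, P a b e (fun _ => 0) (fun _ => 0) z|
      ≤ ∑ a' : Fin N → Fin 2, ∑ b : Fin N → Fin 2,
          ∑ x : Fin N → Fin M, ∑ y : Fin N → Fin M,
            |∑ a ∈ 𝒜, η a * ∏ n, βa M (a n) (a' n) (b n) (x n) (y n)|
            * ∑ e, P a' b e x y z₀ := by
  intro z z₀ 𝒜 η
  have hmarg : ∀ e a, ∑ b, P a b e (fun _ => 0) (fun _ => 0) z
      = ∑ a', ∑ b, ∑ x, ∑ y, (∏ n, βa M (a n) (a' n) (b n) (x n) (y n)) * P a' b e x y z :=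
    fun e a => (sum_prod_βa_mul_eq_marginal M hM N (fun a b x y => P a b e x y z)
      (fun n a b x x' y h => nsA n a b e x x' y z h)
      (fun n a b x y y' h => nsB n a b e x y y' z h) a).symm
  have hbound : ∀ e, |∑ a ∈ 𝒜, η a * ∑ b, P a b e (fun _ => 0) (fun _ => 0) z|
      ≤ ∑ a', ∑ b, ∑ x, ∑ y,
        |∑ a ∈ 𝒜, η a * ∏ n, βa M (a n) (a' n) (b n) (x n) (y n)| * P a' b e x y z := by
    intro e
    have hlin : ∑ a ∈ 𝒜, η a * ∑ b, P a b e (fun _ => 0) (fun _ => 0) z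
        = ∑ a', ∑ b, ∑ x, ∑ y,
          (∑ a ∈ 𝒜, η a * ∏ n, βa M (a n) (a' n) (b n) (x n) (y n)) * P a' b e x y z := by
      simp only [hmarg, Finset.mul_sum, Finset.sum_mul, mul_assoc]
      iterate 3
        rw [Finset.sum_comm]
        refine Finset.sum_congr rfl fun _ _ => ?_
      rw [Finset.sum_comm]
    rw [hlin]
    iterate 4
      refine (Finset.abs_sum_le_sum_abs _ _).trans (Finset.sum_le_sum fun _ _ => ?_)
    rw [abs_mul, abs_of_nonneg (hpos _ _ _ _ _ _)]
  refine (Finset.sum_le_sum fun e _ => hbound e).trans (le_of_eq ?_)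
  simp only [← fun a b x y => nsE a b x y z z₀, Finset.mul_sum]
  iterate 3
    rw [Finset.sum_comm]
    refine Finset.sum_congr rfl fun _ _ => ?_
  rw [Finset.sum_comm]
end

section
/- Let P(𝐚,𝐛,e|𝐱,𝐲,z) be any (2N+1)-partite nonsignaling conditional distribution, let f: {0,1}^N → {0,1}^{N_c} be a given function, and let G: {0,1}^N → {0,1}^{N_s} be a two-universal random function (independent of everything else). Define, for k ∈ {0,1}^{N_s}, c ∈ {0,1}^{N_c}, e ∈ ℰ, functions g, and inputs z: P_{K,C,E,G|𝐗,Z}(k,c,e,g|𝟎,z) = P_G(g) · Σ_{𝐚 : g(𝐚)=k, f(𝐚)=c} P_{𝐀,E|𝐗,Z}(𝐚,e|𝟎,z) and P_{C,E,G|𝐗,Z}(c,e,g|𝟎,z) = P_G(g) · Σ_{𝐚 : f(𝐚)=c} P_{𝐀,E|𝐗,Z}(𝐚,e|𝟎,z), where P_{𝐀,E|𝐗,Z}(𝐚,e|𝟎,z) = Σ_𝐛 P(𝐚,𝐛,e|𝟎,𝐲,z) (independent of 𝐲 by nonsignaling). Then Σ_{k,c,g} max_z Σ_e | P_{K,C,E,G|𝐗,Z}(k,c,e,g|𝟎,z)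 − 2^{−N_s} P_{C,E,G|𝐗,Z}(c,e,g|𝟎,z) | ≤ (√2)^{N+N_s+N_c+1} · ⟨ℬ_1⋯ℬ_N⟩. -/
open scoped Classical
open Finset

set_option linter.unusedVariables false

/-- Local functionals that agree on every one-coordinate slice of `R` have product functionals
that agree on `R`. -/
lemma sum_prod_mul_eq_of_slices {Q : Type} [Fintype Q] :
    ∀ (N : ℕ) (l l' : Fin N → Q → ℝ) (R : (Fin N → Q) → ℝ),
      (∀ n q, ∑ v, l n v * R (Function.update q n v)
        = ∑ v, l' n v * R (Function.update q n v)) →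
      ∑ q : Fin N → Q, (∏ n, l n (q n)) * R q = ∑ q : Fin N → Q, (∏ n, l' n (q n)) * R q := by
  intro N
  induction N with
  | zero => intro l l' R _; simp
  | succ N ih =>
    intro l l' R h
    have expand : ∀ l : Fin (N + 1) → Q → ℝ,
        ∑ q : Fin (N + 1) → Q, (∏ n, l n (q n)) * R q
          = ∑ q : Fin N → Q, (∏ n : Fin N, l n.succ (q n))
              * ∑ v, l 0 v * R (Fin.cons v q : Fin (N + 1) → Q) := by
      intro l
      rw [← (Fin.consEquiv (fun _ : Fin (N + 1) => Q)).sum_comp, Fintype.sum_prod_type,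
        Finset.sum_comm]
      refine Finset.sum_congr rfl fun q _ => ?_
      rw [Finset.mul_sum]
      refine Finset.sum_congr rfl fun v _ => ?_
      change (∏ n, l n ((Fin.cons v q : Fin (N + 1) → Q) n)) * R (Fin.cons v q) = _
      simp only [Fin.prod_univ_succ, Fin.cons_zero, Fin.cons_succ]
      ring
    rw [expand l, expand l']
    have h0 : ∀ q : Fin N → Q, ∑ v, l 0 v * R (Fin.cons v q : Fin (N + 1) → Q)
        = ∑ v, l' 0 v * R (Fin.cons v q : Fin (N + 1) → Q) := by
      intro q
      rcases isEmpty_or_nonempty Q with hQ | ⟨⟨v0⟩⟩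
      · simp
      · have := h 0 (Fin.cons v0 q : Fin (N + 1) → Q)
        simpa only [Fin.update_cons_zero] using this
    simp_rw [← h0]
    refine ih (fun n => l n.succ) (fun n => l' n.succ)
      (fun q => ∑ v, l 0 v * R (Fin.cons v q : Fin (N + 1) → Q)) ?_
    intro n q
    simp_rw [Finset.mul_sum]
    rw [Finset.sum_comm, Finset.sum_comm (f := fun v w => l' n.succ v * _)]
    refine Finset.sum_congr rfl fun w _ => ?_
    have := h n.succ (Fin.cons w q : Fin (N + 1) → Q)
    simp only [← Fin.cons_update] at this
    calc _ = l 0 w * ∑ v, l n.succ v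
              * R (Fin.cons w (Function.update q n v) : Fin (N + 1) → Q) := by
            rw [Finset.mul_sum]; exact Finset.sum_congr rfl fun v _ => by ring
      _ = _ := by
            rw [this, Finset.mul_sum]; exact Finset.sum_congr rfl fun v _ => by ring

/-- The centred indicator of the event `g γ s = k`, restricted to `f s = c`. -/
noncomputable def centredIndicator {A K C : Type} (δ : ℝ) (g : A → K) (f : A → C)
    (k : K) (c : C) (s : A) : ℝ :=
  if f s = c then (if g s = k then 1 else 0) - δ else 0

lemma sum_centredIndicator_mul {A K C : Type} [Fintype K] [Fintype C] (δ : ℝ)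
    (hδ : (Fintype.card K : ℝ) * δ = 1) (g : A → K) (f : A → C) (s s' : A) :
    ∑ k, ∑ c, centredIndicator δ g f k c s * centredIndicator δ g f k c s'
      = if f s = f s' then (if g s = g s' then 1 else 0) - δ else 0 := by
  have hc : ∀ k, ∑ c, centredIndicator δ g f k c s * centredIndicator δ g f k c s'
      = if f s = f s' then
          ((if g s = k then 1 else 0) - δ) * ((if g s' = k then 1 else 0) - δ) else 0 := by
    intro k
    rw [Finset.sum_eq_single (f s)]
    · by_cases h : f s = f s'
      · simp [centredIndicator, h]
      · have h' : ¬ f s' = f s := fun e => h e.symm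
        simp [centredIndicator, h, h']
    · intro c _ hc
      simp [centredIndicator, hc.symm]
    · simp
  simp_rw [hc]
  by_cases h : f s = f s'
  · simp only [h, if_true]
    have : ∀ k, ((if g s = k then (1 : ℝ) else 0) - δ) * ((if g s' = k then 1 else 0) - δ)
        = (if g s = k then (if g s' = k then 1 else 0) else 0)
          - δ * (if g s = k then 1 else 0) - δ * (if g s' = k then 1 else 0) + δ * δ := by
      intro k; split_ifs <;> ring
    simp_rw [this, Finset.sum_add_distrib, Finset.sum_sub_distrib, ← Finset.mul_sum]
    simp only [Finset.sum_ite_eq, Finset.mem_univ, if_true, Finset.sum_const, Finset.card_univ,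
      nsmul_eq_mul]
    rw [hδ]
    by_cases hg : g s = g s'
    · simp [hg]
    · have hg' : ¬ g s' = g s := fun e => hg e.symm
      simp [hg, hg']
  · simp [h]

/-- For a two-universal family, the centred fibre sums of a function bounded by `B` have
second moment at most `2 |A| B²`. -/
lemma sum_sq_centred_le {A K C G : Type} [Fintype A] [Fintype K] [Fintype C] [Fintype G]
    (δ : ℝ) (hδ0 : 0 ≤ δ) (hδ1 : δ ≤ 1) (hδ : (Fintype.card K : ℝ) * δ = 1)
    (f : A → C) (PG : G → ℝ) (hPG0 : ∀ γ, 0 ≤ PG γ) (hPG1 : ∑ γ, PG γ = 1) (g : G → A → K)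
    (huniv : ∀ a a', a ≠ a' → ∑ γ, PG γ * (if g γ a = g γ a' then 1 else 0) ≤ δ)
    (v : A → ℝ) (B : ℝ) (hv : ∀ s, |v s| ≤ B) :
    ∑ k, ∑ c, ∑ γ, PG γ * (∑ s, centredIndicator δ (g γ) f k c s * v s) ^ 2
      ≤ 2 * Fintype.card A * B ^ 2 := by
  set W : A → A → ℝ := fun s s' => ∑ γ, PG γ *
    ∑ k, ∑ c, centredIndicator δ (g γ) f k c s * centredIndicator δ (g γ) f k c s' with hW
  have hexp : ∀ v : A → ℝ,
      ∑ k, ∑ c, ∑ γ, PG γ * (∑ s, centredIndicator δ (g γ) f k c s * v s) ^ 2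
        = ∑ s, ∑ s', v s * v s' * W s s' := by
    intro v
    have h1 : ∀ γ k c, (∑ s, centredIndicator δ (g γ) f k c s * v s) ^ 2
        = ∑ s, ∑ s', v s * v s' *
          (centredIndicator δ (g γ) f k c s * centredIndicator δ (g γ) f k c s') := by
      intro γ k c
      rw [sq, Finset.sum_mul_sum]
      exact Finset.sum_congr rfl fun s _ => Finset.sum_congr rfl fun s' _ => by ring
    have h2 : ∀ s s', v s * v s' * W s s' = ∑ k, ∑ c, ∑ γ, PG γ * (v s * v s' *
          (centredIndicator δ (g γ) f k c s * centredIndicator δ (g γ) f k c s')) := by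
      intro s s'
      simp only [hW, Finset.mul_sum]
      rw [Finset.sum_comm]
      refine Finset.sum_congr rfl fun k _ => ?_
      rw [Finset.sum_comm]
      exact Finset.sum_congr rfl fun c _ => Finset.sum_congr rfl fun γ _ => by ring
    simp_rw [h1, h2, Finset.mul_sum]
    have e := Finset.sum_comm (s := Finset.univ) (t := Finset.univ)
      (f := fun (i : K × C × G) (p : A × A) => PG i.2.2 * (v p.1 * v p.2 *
        (centredIndicator δ (g i.2.2) f i.1 i.2.1 p.1 *
          centredIndicator δ (g i.2.2) f i.1 i.2.1 p.2)))
    simpa only [Fintype.sum_prod_type] using e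
  have hWval : ∀ s s', W s s' = if f s = f s' then
      (∑ γ, PG γ * (if g γ s = g γ s' then 1 else 0)) - δ else 0 := by
    intro s s'
    simp only [hW, sum_centredIndicator_mul δ hδ]
    by_cases h : f s = f s'
    · simp only [h, if_true, mul_sub, Finset.sum_sub_distrib, ← Finset.sum_mul, hPG1, one_mul]
    · simp [h]
  have hWabs : ∀ s s', |W s s'| ≤ (if s = s' then 2 else 0) - W s s' := by
    intro s s'
    by_cases h : s = s'
    · subst h
      have : W s s = 1 - δ := by simp [hWval, hPG1]
      rw [this, abs_of_nonneg (by linarith)]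
      simp; linarith
    · have : W s s' ≤ 0 := by
        rw [hWval]
        split_ifs
        · linarith [huniv s s' h]
        · exact le_rfl
      rw [abs_of_nonpos this]; simp [h]
  have hW0 : 0 ≤ ∑ s, ∑ s', W s s' := by
    have := hexp (fun _ => 1)
    simp only [mul_one, one_mul] at this
    rw [← this]
    exact Finset.sum_nonneg fun k _ => Finset.sum_nonneg fun c _ => Finset.sum_nonneg fun γ _ =>
      mul_nonneg (hPG0 γ) (sq_nonneg _)
  rw [hexp]
  calc ∑ s, ∑ s', v s * v s' * W s s'
      ≤ ∑ s, ∑ s', B ^ 2 * ((if s = s' then 2 else 0) - W s s') := by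
        refine Finset.sum_le_sum fun s _ => Finset.sum_le_sum fun s' _ => ?_
        refine (le_abs_self _).trans ?_
        rw [abs_mul, abs_mul, sq]
        have hB : 0 ≤ B := (abs_nonneg _).trans (hv s)
        exact mul_le_mul (mul_le_mul (hv s) (hv s') (abs_nonneg _) hB) (hWabs s s')
          (abs_nonneg _) (mul_nonneg hB hB)
    _ = B ^ 2 * (2 * Fintype.card A - ∑ s, ∑ s', W s s') := by
        simp_rw [← Finset.mul_sum, Finset.sum_sub_distrib]
        simp [mul_comm]
    _ ≤ _ := by nlinarith [sq_nonneg B]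

lemma sum_abs_centred_le {A K C G : Type} [Fintype A] [Fintype K] [Fintype C] [Fintype G]
    (δ : ℝ) (hδ0 : 0 ≤ δ) (hδ1 : δ ≤ 1) (hδ : (Fintype.card K : ℝ) * δ = 1)
    (f : A → C) (PG : G → ℝ) (hPG0 : ∀ γ, 0 ≤ PG γ) (hPG1 : ∑ γ, PG γ = 1) (g : G → A → K)
    (huniv : ∀ a a', a ≠ a' → ∑ γ, PG γ * (if g γ a = g γ a' then 1 else 0) ≤ δ)
    (v : A → ℝ) (B : ℝ) (hB : 0 ≤ B) (hv : ∀ s, |v s| ≤ B) :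
    ∑ k, ∑ c, ∑ γ, PG γ * |∑ s, centredIndicator δ (g γ) f k c s * v s|
      ≤ √((Fintype.card K * Fintype.card C) * (2 * Fintype.card A)) * B := by
  have key := sum_sq_centred_le δ hδ0 hδ1 hδ f PG hPG0 hPG1 g huniv v B hv
  have cs := Finset.sum_sq_le_sum_mul_sum_of_sq_le_mul (Finset.univ : Finset (K × C × G))
    (r := fun i => PG i.2.2 * |∑ s, centredIndicator δ (g i.2.2) f i.1 i.2.1 s * v s|)
    (f := fun i => PG i.2.2)
    (g := fun i => PG i.2.2 * (∑ s, centredIndicator δ (g i.2.2) f i.1 i.2.1 s * v s) ^ 2)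
    (fun i _ => hPG0 _) (fun i _ => mul_nonneg (hPG0 _) (sq_nonneg _))
    (fun i _ => le_of_eq (by rw [mul_pow, sq_abs]; ring))
  simp only [Fintype.sum_prod_type] at cs
  have h1 : ∑ k : K, ∑ c : C, ∑ γ, PG γ = Fintype.card K * Fintype.card C := by
    simp [hPG1]
  rw [h1] at cs
  rw [← Real.sqrt_sq hB, ← Real.sqrt_mul (by positivity)]
  apply Real.le_sqrt_of_sq_le
  refine cs.trans ?_
  rw [mul_assoc ((Fintype.card K : ℝ) * _)]
  exact mul_le_mul_of_nonneg_left key (by positivity)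

/-- The sign `(-1)^a`. -/
def bitSign (a : Fin 2) : ℝ := if a = 0 then 1 else -1

/-- Coefficients reconstructing the probability of outcome `s` for input `0` from the
correlations of the input pairs in the chain. -/
noncomputable def chainCoeff (M : ℕ) [NeZero M] (s a b : Fin 2) (x y : Fin M) : ℝ :=
  if Sprop x y then 1 / (2 * (M : ℝ)) * (1 / 2 + M * (bitSign s *
    ((if y = x ∧ x ≠ 0 then -1 else 1) *
      ((bitSign a - (if (x : ℕ) = M - 1 ∧ (y : ℕ) = 0 then -1 else 1) * bitSign b) / 2)))) else 0

lemma abs_chainCoeff_le (M : ℕ) [NeZero M] (s a b : Fin 2) (x y : Fin M) :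
    |chainCoeff M s a b x y|
      ≤ if Sprop x y then 1 / (2 * (M : ℝ)) * BC M a b x y else 0 := by
  unfold chainCoeff
  by_cases h : Sprop x y
  · rw [if_pos h, if_pos h, abs_mul, abs_of_nonneg (show 0 ≤ 1 / (2 * (M : ℝ)) by positivity)]
    refine mul_le_mul_of_nonneg_left ?_ (by positivity)
    have hM : (0 : ℝ) ≤ M := by positivity
    unfold BC
    clear h
    rw [abs_le]
    split_ifs <;> fin_cases s <;> fin_cases a <;> fin_cases b <;> simp [bitSign] <;>
      (try constructor) <;> linarith
  · simp [h]

lemma sum_Sprop {M : ℕ} [NeZero M] (hM : 2 ≤ M) (F : Fin M → Fin M → ℝ) :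
    ∑ x, ∑ y, (if Sprop x y then F x y else 0) = ∑ x, F x x + ∑ x, F x (x + 1) := by
  rw [← Finset.sum_add_distrib]
  refine Finset.sum_congr rfl fun x _ => ?_
  have hne : x ≠ x + 1 := by
    obtain ⟨m, rfl⟩ : ∃ m, M = m + 2 := ⟨M - 2, by omega⟩
    simp
  rw [← Finset.sum_filter]
  have : Finset.univ.filter (fun y => Sprop x y) = {x, x + 1} := by
    ext y
    simp only [Finset.mem_filter, Finset.mem_univ, true_and, Finset.mem_insert,
      Finset.mem_singleton]
    exact Iff.rfl
  rw [this, Finset.sum_pair hne]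

/-- In a bipartite nonsignaling box, the marginal of the first party at input `0` is
recovered by `chainCoeff`. -/
lemma marginal_eq_sum_chainCoeff {M : ℕ} [NeZero M] (hM : 2 ≤ M)
    (r : Fin 2 → Fin 2 → Fin M → Fin M → ℝ)
    (hA : ∀ b x x' y, ∑ a, r a b x y = ∑ a, r a b x' y)
    (hB : ∀ a x y y', ∑ b, r a b x y = ∑ b, r a b x y') (s : Fin 2) :
    ∑ b, r s b 0 0 = ∑ a, ∑ b, ∑ x, ∑ y, chainCoeff M s a b x y * r a b x y := by
  simp only [Fin.sum_univ_two] at hA hB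
  set A : Fin M → ℝ := fun x => (r 0 0 x 0 + r 0 1 x 0) - (r 1 0 x 0 + r 1 1 x 0) with hAd
  set B : Fin M → ℝ := fun y => (r 0 0 0 y + r 1 0 0 y) - (r 0 1 0 y + r 1 1 0 y) with hBd
  set t : ℝ := r 0 0 0 0 + r 0 1 0 0 + r 1 0 0 0 + r 1 1 0 0 with ht
  have hM0 : (M : ℝ) ≠ 0 := by positivity
  set T : Fin M → Fin M → ℝ := fun x y => if y = x ∧ x ≠ 0 then -1 else 1
  set φ : Fin M → Fin M → ℝ := fun x y => if (x : ℕ) = M - 1 ∧ (y : ℕ) = 0 then -1 else 1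
  have hsum : ∑ a, ∑ b, ∑ x, ∑ y, chainCoeff M s a b x y * r a b x y
      = ∑ x, ∑ y, if Sprop x y then 1 / (2 * (M : ℝ)) * (t / 2 + M * (bitSign s *
          (T x y * ((A x - φ x y * B y) / 2)))) else 0 := by
    simp only [Fin.sum_univ_two, ← Finset.sum_add_distrib]
    refine Finset.sum_congr rfl fun x _ => Finset.sum_congr rfl fun y _ => ?_
    by_cases h : Sprop x y
    · have hc : ∀ a b, chainCoeff M s a b x y = 1 / (2 * (M : ℝ)) * (1 / 2 + M * (bitSign s *
          (T x y * ((bitSign a - φ x y * bitSign b) / 2)))) := fun a b => if_pos h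
      have b0 : bitSign 0 = 1 := by simp [bitSign]
      have b1 : bitSign 1 = -1 := by simp [bitSign]
      rw [if_pos h]
      have e1 : A x = (r 0 0 x y + r 0 1 x y) - (r 1 0 x y + r 1 1 x y) := by
        simp only [hAd]; linarith [hB 0 x 0 y, hB 1 x 0 y]
      have e2 : B y = (r 0 0 x y + r 1 0 x y) - (r 0 1 x y + r 1 1 x y) := by
        simp only [hBd]; linarith [hA 0 0 x y, hA 1 0 x y]
      have e3 : t = r 0 0 x y + r 0 1 x y + r 1 0 x y + r 1 1 x y := by
        linarith [hB 0 0 0 y, hB 1 0 0 y, hA 0 0 x y, hA 1 0 x y]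
      rw [e1, e2, e3]
      simp only [hc, b0, b1]
      ring
    · simp [chainCoeff, h]
  rw [hsum, sum_Sprop hM]
  have hφ1 : ∀ x : Fin M, φ x x = 1 := by
    intro x; simp only [φ]; rw [if_neg]; omega
  have hφ2 : ∀ x : Fin M, φ x (x + 1) = if x + 1 = 0 then -1 else 1 := by
    intro x
    simp only [φ]
    obtain ⟨m, rfl⟩ : ∃ m, M = m + 2 := ⟨M - 2, by omega⟩
    congr 1
    rw [eq_iff_iff, Fin.ext_iff]
    constructor
    · rintro ⟨_, h⟩; simpa using h
    · intro h
      refine ⟨?_, by simpa using h⟩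
      rw [Fin.val_add_one] at h
      split_ifs at h with h'
      · simp [h']
      · simp at h
  have hT1 : ∀ x : Fin M, T x x = if x = 0 then 1 else -1 := by
    intro x; by_cases h : x = 0 <;> simp [T, h]
  have hT2 : ∀ x : Fin M, T x (x + 1) = 1 := by
    intro x
    simp only [T]
    rw [if_neg]
    obtain ⟨m, rfl⟩ : ∃ m, M = m + 2 := ⟨M - 2, by omega⟩
    simp
  simp only [hφ1, hφ2, hT1, hT2]
  have shift : ∑ x : Fin M, (if x + 1 = 0 then (-1 : ℝ) else 1) * B (x + 1)
      = ∑ x : Fin M, B x - 2 * B 0 := by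
    refine (Equiv.sum_comp (Equiv.addRight (1 : Fin M))
      (fun y => (if y = 0 then (-1 : ℝ) else 1) * B y)).trans ?_
    have : ∀ y : Fin M, (if y = 0 then (-1 : ℝ) else 1) * B y
        = B y - (if y = 0 then 2 * B y else 0) := by
      intro y; split_ifs <;> ring
    simp_rw [this, Finset.sum_sub_distrib]
    simp
  have diag : ∑ x : Fin M, (if x = 0 then (1 : ℝ) else -1) * (A x - B x)
      = 2 * (A 0 - B 0) - (∑ x, A x - ∑ x, B x) := by
    have : ∀ y : Fin M, (if y = 0 then (1 : ℝ) else -1) * (A y - B y)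
        = (if y = 0 then 2 * (A y - B y) else 0) - (A y - B y) := by
      intro y; split_ifs <;> ring
    simp_rw [this, Finset.sum_sub_distrib]
    simp
  have s1 : ∑ x : Fin M, 1 / (2 * (M : ℝ)) * (t / 2 + M * (bitSign s *
        ((if x = 0 then 1 else -1) * ((A x - 1 * B x) / 2))))
      = t / 4 + bitSign s / 4 * (2 * (A 0 - B 0) - (∑ x, A x - ∑ x, B x)) := by
    rw [← diag, Finset.mul_sum]
    have : t / 4 = ∑ x : Fin M, t / (4 * M) := by
      simp; field_simp
    rw [this, ← Finset.sum_add_distrib]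
    refine Finset.sum_congr rfl fun x _ => ?_
    field_simp
    ring
  have s2 : ∑ x : Fin M, 1 / (2 * (M : ℝ)) * (t / 2 + M * (bitSign s *
        (1 * ((A x - (if x + 1 = 0 then -1 else 1) * B (x + 1)) / 2))))
      = t / 4 + bitSign s / 4 * (∑ x, A x - (∑ x, B x - 2 * B 0)) := by
    rw [← shift, ← Finset.sum_sub_distrib, Finset.mul_sum]
    have : t / 4 = ∑ x : Fin M, t / (4 * M) := by
      simp; field_simp
    rw [this, ← Finset.sum_add_distrib]
    refine Finset.sum_congr rfl fun x _ => ?_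
    field_simp
    ring
  rw [s1, s2]
  simp only [Fin.sum_univ_two, hAd, ht]
  fin_cases s <;> simp [bitSign] <;> ring

lemma sum_pi_quadruple {N : ℕ} {X Y : Type} [Fintype X] [Fintype Y]
    (F : (Fin N → X) → (Fin N → X) → (Fin N → Y) → (Fin N → Y) → ℝ) :
    ∑ q : Fin N → X × X × Y × Y,
        F (fun n => (q n).1) (fun n => (q n).2.1) (fun n => (q n).2.2.1) (fun n => (q n).2.2.2)
      = ∑ a, ∑ b, ∑ x, ∑ y, F a b x y := by
  rw [← (Equiv.arrowProdEquivProdArrow (Fin N) (fun _ => X) (fun _ => X × Y × Y)).symm.sum_comp,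
    Fintype.sum_prod_type]
  refine Finset.sum_congr rfl fun a _ => ?_
  rw [← (Equiv.arrowProdEquivProdArrow (Fin N) (fun _ => X) (fun _ => Y × Y)).symm.sum_comp,
    Fintype.sum_prod_type]
  refine Finset.sum_congr rfl fun b _ => ?_
  rw [← (Equiv.arrowProdEquivProdArrow (Fin N) (fun _ => Y) (fun _ => Y)).symm.sum_comp,
    Fintype.sum_prod_type]
  rfl

/-- The first parties' marginal at input `0` of a multipartite nonsignaling distribution, as a
product combination over the chain. -/
lemma marginal_eq_sum_prod_chainCoeff {M N : ℕ} [NeZero M] (hM : 2 ≤ M)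
    (R : (Fin N → Fin 2) → (Fin N → Fin 2) → (Fin N → Fin M) → (Fin N → Fin M) → ℝ)
    (nsA : ∀ (n : Fin N) (a b : Fin N → Fin 2) (x x' y : Fin N → Fin M),
      (∀ m, m ≠ n → x m = x' m) →
      ∑ v : Fin 2, R (Function.update a n v) b x y = ∑ v : Fin 2, R (Function.update a n v) b x' y)
    (nsB : ∀ (n : Fin N) (a b : Fin N → Fin 2) (x y y' : Fin N → Fin M),
      (∀ m, m ≠ n → y m = y' m) →
      ∑ v : Fin 2, R a (Function.update b n v) x y = ∑ v : Fin 2, R a (Function.update b n v) x y')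
    (s : Fin N → Fin 2) :
    ∑ b, R s b (fun _ => 0) (fun _ => 0)
      = ∑ a, ∑ b, ∑ x, ∑ y, (∏ n, chainCoeff M (s n) (a n) (b n) (x n) (y n)) * R a b x y := by
  have key := sum_prod_mul_eq_of_slices N
    (fun n (q : Fin 2 × Fin 2 × Fin M × Fin M) =>
      if q.1 = s n ∧ q.2.2.1 = 0 ∧ q.2.2.2 = 0 then (1 : ℝ) else 0)
    (fun n q => chainCoeff M (s n) q.1 q.2.1 q.2.2.1 q.2.2.2)
    (fun q => R (fun n => (q n).1) (fun n => (q n).2.1) (fun n => (q n).2.2.1)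
      (fun n => (q n).2.2.2)) ?_
  · rw [sum_pi_quadruple (fun a b x y =>
        (∏ n, if a n = s n ∧ x n = 0 ∧ y n = 0 then (1 : ℝ) else 0) * R a b x y),
      sum_pi_quadruple (fun a b x y =>
        (∏ n, chainCoeff M (s n) (a n) (b n) (x n) (y n)) * R a b x y)] at key
    rw [← key]
    have hprod : ∀ (a : Fin N → Fin 2) (x y : Fin N → Fin M),
        (∏ n, if a n = s n ∧ x n = 0 ∧ y n = 0 then (1 : ℝ) else 0)
          = if a = s ∧ x = (fun _ => 0) ∧ y = (fun _ => 0) then 1 else 0 := by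
      intro a x y
      rw [Finset.prod_ite_zero]
      simp only [Finset.prod_const_one, Finset.mem_univ, true_imp_iff, forall_and, funext_iff]
    simp only [hprod]
    simp only [ite_mul, one_mul, zero_mul, ite_and]
    simp
  · intro n q
    have hu : ∀ v : Fin 2 × Fin 2 × Fin M × Fin M,
        R (fun m => (Function.update q n v m).1) (fun m => (Function.update q n v m).2.1)
          (fun m => (Function.update q n v m).2.2.1) (fun m => (Function.update q n v m).2.2.2)
        = R (Function.update (fun m => (q m).1) n v.1) (Function.update (fun m => (q m).2.1) n v.2.1)
          (Function.update (fun m => (q m).2.2.1) n v.2.2.1)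
          (Function.update (fun m => (q m).2.2.2) n v.2.2.2) := by
      intro v
      congr 1 <;> funext m <;> by_cases h : m = n <;> simp [h]
    simp only [hu, Fintype.sum_prod_type]
    rw [← marginal_eq_sum_chainCoeff hM (fun a b x y => R (Function.update (fun m => (q m).1) n a)
      (Function.update (fun m => (q m).2.1) n b) (Function.update (fun m => (q m).2.2.1) n x)
      (Function.update (fun m => (q m).2.2.2) n y))]
    · simp only [ite_mul, one_mul, zero_mul, ite_and]
      simp
    · intro b x x' y
      exact nsA n _ _ _ _ _ fun m hm => by simp [hm]
    · intro a x y y'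
      exact nsB n _ _ _ _ _ fun m hm => by simp [hm]

/-- Theorem 9 of the paper (privacy amplification): for any `(2N+1)`-partite nonsignaling
conditional distribution, any error-correction function `f`, and any two-universal random
function `G`, the distance of the hashed key from an ideal key is bounded by
`(√2)^{N+N_s+N_c+1}·⟨ℬ₁⋯ℬ_N⟩`. -/
theorem privacy_amplification
    (M N Nc Ns : ℕ) [NeZero M] (hM : 2 ≤ M) (hN : 1 ≤ N)
    {E Z : Type} [Fintype E] [Fintype Z] [Nonempty Z]
    (P : (Fin N → Fin 2) → (Fin N → Fin 2) → E →
         (Fin N → Fin M) → (Fin N → Fin M) → Z → ℝ)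
    (hpos : ∀ a b e x y z, 0 ≤ P a b e x y z)
    (hnorm : ∀ x y z, ∑ a, ∑ b, ∑ e, P a b e x y z = 1)
    (nsA : ∀ (n : Fin N) (a b : Fin N → Fin 2) (e : E) (x x' y : Fin N → Fin M) (z : Z),
      (∀ m, m ≠ n → x m = x' m) →
      ∑ v : Fin 2, P (Function.update a n v) b e x y z
        = ∑ v : Fin 2, P (Function.update a n v) b e x' y z)
    (nsB : ∀ (n : Fin N) (a b : Fin N → Fin 2) (e : E) (x y y' : Fin N → Fin M) (z : Z),
      (∀ m, m ≠ n → y m = y' m) →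
      ∑ v : Fin 2, P a (Function.update b n v) e x y z
        = ∑ v : Fin 2, P a (Function.update b n v) e x y' z)
    (nsE : ∀ a b x y (z z' : Z), ∑ e, P a b e x y z = ∑ e, P a b e x y z')
    (f : (Fin N → Fin 2) → (Fin Nc → Fin 2))
    {G : Type} [Fintype G]
    (PG : G → ℝ) (hPG0 : ∀ γ, 0 ≤ PG γ) (hPG1 : ∑ γ, PG γ = 1)
    (g : G → (Fin N → Fin 2) → (Fin Ns → Fin 2))
    (huniv : ∀ a a' : Fin N → Fin 2, a ≠ a' →
      ∑ γ, PG γ * (if g γ a = g γ a' then 1 else 0) ≤ ((2 : ℝ) ^ Ns)⁻¹) :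
    ∀ z₀ : Z,
      ∑ k : Fin Ns → Fin 2, ∑ c : Fin Nc → Fin 2, ∑ γ : G,
        Finset.univ.sup' Finset.univ_nonempty (fun z : Z =>
          ∑ e : E,
            |PG γ * (∑ a ∈ Finset.univ.filter
                  (fun a : Fin N → Fin 2 => g γ a = k ∧ f a = c),
                ∑ b, P a b e (fun _ => 0) (fun _ => 0) z)
              - ((2 : ℝ) ^ Ns)⁻¹ * (PG γ * (∑ a ∈ Finset.univ.filter
                  (fun a : Fin N → Fin 2 => f a = c),
                ∑ b, P a b e (fun _ => 0) (fun _ => 0) z))|)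
      ≤ Real.sqrt 2 ^ (N + Ns + Nc + 1) *
          ∑ a : Fin N → Fin 2, ∑ b : Fin N → Fin 2,
            ∑ x : Fin N → Fin M, ∑ y : Fin N → Fin M,
              (if ∀ n, Sprop (x n) (y n) then
                  (1 / (2 * (M : ℝ))) ^ N * ∏ n, BC M (a n) (b n) (x n) (y n)
                else 0)
              * ∑ e, P a b e x y z₀ := by
  intro z₀
  set δ : ℝ := ((2 : ℝ) ^ Ns)⁻¹ with hδd
  have hδ : (Fintype.card (Fin Ns → Fin 2) : ℝ) * δ = 1 := by
    simp [hδd]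
  have hδ0 : 0 ≤ δ := by positivity
  have hδ1 : δ ≤ 1 := inv_le_one_of_one_le₀ (one_le_pow₀ (by norm_num))
  set V : (Fin N → Fin 2) → (Fin N → Fin 2) → (Fin N → Fin 2) → (Fin N → Fin M) →
      (Fin N → Fin M) → ℝ :=
    fun s a b x y => ∏ n, chainCoeff M (s n) (a n) (b n) (x n) (y n) with hVd
  set H : G → (Fin Ns → Fin 2) → (Fin Nc → Fin 2) → (Fin N → Fin 2) → (Fin N → Fin 2) →
      (Fin N → Fin M) → (Fin N → Fin M) → ℝ :=
    fun γ k c a b x y => |∑ s, centredIndicator δ (g γ) f k c s * V s a b x y| with hHd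
  set B : (Fin N → Fin 2) → (Fin N → Fin 2) → (Fin N → Fin M) → (Fin N → Fin M) → ℝ :=
    fun a b x y => if ∀ n, Sprop (x n) (y n) then
      (1 / (2 * (M : ℝ))) ^ N * ∏ n, BC M (a n) (b n) (x n) (y n) else 0 with hBd
  have hVB : ∀ s a b x y, |V s a b x y| ≤ B a b x y := by
    intro s a b x y
    simp only [hVd, hBd, Finset.abs_prod]
    refine (Finset.prod_le_prod (fun _ _ => abs_nonneg _)
      fun n _ => abs_chainCoeff_le M (s n) (a n) (b n) (x n) (y n)).trans ?_
    rw [Finset.prod_ite_zero]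
    simp [Finset.prod_mul_distrib]
  have hB0 : ∀ a b x y, 0 ≤ B a b x y := fun a b x y =>
    (abs_nonneg _).trans (hVB a a b x y)
  have hmain : ∀ k c γ e z,
      |PG γ * (∑ a ∈ Finset.univ.filter (fun a : Fin N → Fin 2 => g γ a = k ∧ f a = c),
            ∑ b, P a b e (fun _ => 0) (fun _ => 0) z)
          - δ * (PG γ * (∑ a ∈ Finset.univ.filter (fun a : Fin N → Fin 2 => f a = c),
            ∑ b, P a b e (fun _ => 0) (fun _ => 0) z))|
        ≤ PG γ * ∑ a, ∑ b, ∑ x, ∑ y, H γ k c a b x y * P a b e x y z := by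
    intro k c γ e z
    have hm := marginal_eq_sum_prod_chainCoeff hM (fun a b x y => P a b e x y z)
      (fun n a b x x' y => nsA n a b e x x' y z) (fun n a b x y y' => nsB n a b e x y y' z)
    have e1 : PG γ * (∑ a ∈ Finset.univ.filter (fun a : Fin N → Fin 2 => g γ a = k ∧ f a = c),
            ∑ b, P a b e (fun _ => 0) (fun _ => 0) z)
          - δ * (PG γ * (∑ a ∈ Finset.univ.filter (fun a : Fin N → Fin 2 => f a = c),
            ∑ b, P a b e (fun _ => 0) (fun _ => 0) z))
        = PG γ * ∑ s, centredIndicator δ (g γ) f k c s *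
            ∑ b, P s b e (fun _ => 0) (fun _ => 0) z := by
      rw [mul_left_comm, ← mul_sub]
      congr 1
      rw [Finset.sum_filter, Finset.sum_filter, Finset.mul_sum, ← Finset.sum_sub_distrib]
      refine Finset.sum_congr rfl fun s _ => ?_
      unfold centredIndicator
      by_cases h1 : g γ s = k <;> by_cases h2 : f s = c <;> simp [h1, h2]
      ring
    have e2 : ∑ s, centredIndicator δ (g γ) f k c s * ∑ b, P s b e (fun _ => 0) (fun _ => 0) z
        = ∑ a, ∑ b, ∑ x, ∑ y, (∑ s, centredIndicator δ (g γ) f k c s * V s a b x y)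
            * P a b e x y z := by
      simp only [hm, Finset.mul_sum, Finset.sum_mul]
      rw [Finset.sum_comm]
      refine Finset.sum_congr rfl fun a _ => ?_
      rw [Finset.sum_comm]
      refine Finset.sum_congr rfl fun b _ => ?_
      rw [Finset.sum_comm]
      refine Finset.sum_congr rfl fun x _ => ?_
      rw [Finset.sum_comm]
      exact Finset.sum_congr rfl fun y _ => Finset.sum_congr rfl fun s _ => by
        simp only [hVd]; ring
    rw [e1, e2, abs_mul, abs_of_nonneg (hPG0 γ)]
    refine mul_le_mul_of_nonneg_left ?_ (hPG0 γ)
    refine (Finset.abs_sum_le_sum_abs _ _).trans (Finset.sum_le_sum fun a _ => ?_)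
    refine (Finset.abs_sum_le_sum_abs _ _).trans (Finset.sum_le_sum fun b _ => ?_)
    refine (Finset.abs_sum_le_sum_abs _ _).trans (Finset.sum_le_sum fun x _ => ?_)
    refine (Finset.abs_sum_le_sum_abs _ _).trans (Finset.sum_le_sum fun y _ => ?_)
    rw [abs_mul, abs_of_nonneg (hpos a b e x y z)]
  have hsup : ∀ k c γ, Finset.univ.sup' Finset.univ_nonempty (fun z : Z => ∑ e : E,
      |PG γ * (∑ a ∈ Finset.univ.filter (fun a : Fin N → Fin 2 => g γ a = k ∧ f a = c),
            ∑ b, P a b e (fun _ => 0) (fun _ => 0) z)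
          - δ * (PG γ * (∑ a ∈ Finset.univ.filter (fun a : Fin N → Fin 2 => f a = c),
            ∑ b, P a b e (fun _ => 0) (fun _ => 0) z))|)
        ≤ ∑ a, ∑ b, ∑ x, ∑ y, PG γ * H γ k c a b x y * ∑ e, P a b e x y z₀ := by
    intro k c γ
    refine Finset.sup'_le _ _ fun z _ => ?_
    refine (Finset.sum_le_sum fun e _ => hmain k c γ e z).trans (le_of_eq ?_)
    simp only [nsE _ _ _ _ z₀ z, Finset.mul_sum]
    rw [Finset.sum_comm]
    refine Finset.sum_congr rfl fun a _ => ?_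
    rw [Finset.sum_comm]
    refine Finset.sum_congr rfl fun b _ => ?_
    rw [Finset.sum_comm]
    refine Finset.sum_congr rfl fun x _ => ?_
    rw [Finset.sum_comm]
    exact Finset.sum_congr rfl fun y _ => Finset.sum_congr rfl fun e _ => by ring
  have hconst : √((Fintype.card (Fin Ns → Fin 2) * Fintype.card (Fin Nc → Fin 2))
      * (2 * Fintype.card (Fin N → Fin 2))) = √2 ^ (N + Ns + Nc + 1) := by
    rw [Real.sqrt_eq_iff_mul_self_eq (by positivity) (by positivity), ← mul_pow,
      Real.mul_self_sqrt (by norm_num)]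
    simp
    ring
  have hH : ∀ a b x y, ∑ k, ∑ c, ∑ γ, PG γ * H γ k c a b x y
      ≤ √2 ^ (N + Ns + Nc + 1) * B a b x y := by
    intro a b x y
    rw [← hconst]
    exact sum_abs_centred_le δ hδ0 hδ1 hδ f PG hPG0 hPG1 g
      (fun a a' h => by convert huniv a a' h) (fun s => V s a b x y)
      (B a b x y) (hB0 a b x y) (fun s => hVB s a b x y)
  calc _ ≤ ∑ k, ∑ c, ∑ γ, ∑ a, ∑ b, ∑ x, ∑ y,
        PG γ * H γ k c a b x y * ∑ e, P a b e x y z₀ :=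
        Finset.sum_le_sum fun k _ => Finset.sum_le_sum fun c _ => Finset.sum_le_sum fun γ _ =>
          hsup k c γ
    _ = ∑ a, ∑ b, ∑ x, ∑ y, (∑ k, ∑ c, ∑ γ, PG γ * H γ k c a b x y)
          * ∑ e, P a b e x y z₀ := by
        simp only [Finset.sum_mul (ι := Fin Ns → Fin 2), Finset.sum_mul (ι := Fin Nc → Fin 2),
          Finset.sum_mul (ι := G)]
        have e1 := fun F : (Fin Ns → Fin 2) × (Fin Nc → Fin 2) × G →
            (Fin N → Fin 2) × (Fin N → Fin 2) × (Fin N → Fin M) × (Fin N → Fin M) → ℝ =>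
          Finset.sum_comm (s := Finset.univ) (t := Finset.univ) (f := F)
        simp only [Fintype.sum_prod_type] at e1
        exact e1 (fun i q => PG i.2.2 * H i.2.2 i.1 i.2.1 q.1 q.2.1 q.2.2.1 q.2.2.2 *
          ∑ e, P q.1 q.2.1 e q.2.2.1 q.2.2.2 z₀)
    _ ≤ ∑ a, ∑ b, ∑ x, ∑ y, (√2 ^ (N + Ns + Nc + 1) * B a b x y)
          * ∑ e, P a b e x y z₀ :=
        Finset.sum_le_sum fun a _ => Finset.sum_le_sum fun b _ => Finset.sum_le_sum fun x _ =>
          Finset.sum_le_sum fun y _ => mul_le_mul_of_nonneg_right (hH a b x y)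
            (Finset.sum_nonneg fun e _ => hpos a b e x y z₀)
    _ = _ := by
        simp only [hBd, mul_assoc, Finset.mul_sum]
end
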